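/- Fix p ∈ [2,∞). The sequence (W^{(n,p)})_{n∈ℕ} of scaled random projections satisfies a large deviation principle with speed n and rate function 𝕀ᵃ_p; moreover 𝕀ᵃ_p is a quasiconvex, symmetric, good rate function. -/

import Mathlib

open MeasureTheory Filter Topology Set ProbabilityTheory
open scoped ENNReal NNReal

noncomputable section

namespace LDP

/-- The nonnegative part of an extended real, as an extended nonnegative real. -/
def erealToENNReal (x : EReal) : ℝ≥0∞ := if x = ⊤ then ⊤ else ENNReal.ofReal x.toReal

/-- Extended (possibly infinite) integral of an `EReal`-valued function:
positive part minus negative part. -/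
def eIntegral (ν : Measure ℝ) (f : ℝ → EReal) : EReal :=
  ((∫⁻ u, erealToENNReal (f u) ∂ν : ℝ≥0∞) : EReal)
    - ((∫⁻ u, erealToENNReal (-f u) ∂ν : ℝ≥0∞) : EReal)

/-- `q`-th absolute moment of a measure on `ℝ`. -/
def mom (q : ℝ) (ν : Measure ℝ) : ℝ≥0∞ := ∫⁻ x, ENNReal.ofReal (|x| ^ q) ∂ν

open Classical in
/-- Relative entropy `H(ν|μ)`. -/
def relEnt (ν μ : Measure ℝ) : EReal :=
  if ν ≪ μ then eIntegral ν (fun x => ENNReal.log (ν.rnDeriv μ x)) else ⊤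

/-- The generalized normal distribution `μ_p` on `ℝ`. -/
def muP (p : ℝ) : Measure ℝ :=
  volume.withDensity fun y =>
    ENNReal.ofReal ((2 * p ^ (1/p) * Real.Gamma (1 + 1/p))⁻¹ * Real.exp (-(|y| ^ p) / p))

/-- The uniform probability measure `μ_∞` on `[-1,1]`. -/
def muInf : Measure ℝ := (volume (Icc (-1:ℝ) 1))⁻¹ • volume.restrict (Icc (-1:ℝ) 1)

/-- Extended-real-valued log moment generating function of a measure on `ℝ`. -/
def logM (γ : Measure ℝ) (t : ℝ) : EReal :=
  ENNReal.log (∫⁻ y, ENNReal.ofReal (Real.exp (t * y)) ∂γ)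

/-- The class `𝒯_q` of measures whose log mgf is dominated by `C|t|^{q/(q-1)} + C`. -/
def memT (q : ℝ) (γ : Measure ℝ) : Prop :=
  ∃ C : ℝ, ∀ t : ℝ, logM γ t ≤ ((C * |t| ^ (q/(q-1)) + C : ℝ) : EReal)

/-- Legendre transform of a function of one real variable. -/
def legendre1 (Λ : ℝ → EReal) (τ : ℝ) : EReal := ⨆ t : ℝ, ((t * τ : ℝ) : EReal) - Λ t

/-- Legendre transform of a function of two real variables. -/
def legendre2 (Λ : ℝ × ℝ → EReal) (τ : ℝ × ℝ) : EReal :=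
  ⨆ t : ℝ × ℝ, ((t.1 * τ.1 + t.2 * τ.2 : ℝ) : EReal) - Λ t

/-- Legendre transform of a function of three real variables. -/
def legendre3 (Λ : ℝ × ℝ × ℝ → EReal) (τ : ℝ × ℝ × ℝ) : EReal :=
  ⨆ t : ℝ × ℝ × ℝ, ((t.1 * τ.1 + t.2.1 * τ.2.1 + t.2.2 * τ.2.2 : ℝ) : EReal) - Λ t

/-- `Φ_p(t₀,t₁,t₂) = log ∫∫ exp(t₀ z² + t₁ z y + t₂ |y|^p) μ₂(dz) μ_p(dy)`. -/
def Phi (p : ℝ) (t : ℝ × ℝ × ℝ) : EReal :=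
  ENNReal.log (∫⁻ y, (∫⁻ z,
    ENNReal.ofReal (Real.exp (t.1 * z^2 + t.2.1 * z * y + t.2.2 * |y| ^ p)) ∂(muP 2)) ∂(muP p))

/-- The annealed rate function `𝕀ᵃ_p` for `p ∈ [2,∞)`. -/
def Ia (p : ℝ) (w : ℝ) : EReal :=
  ⨅ τ ∈ {τ : ℝ × ℝ × ℝ | 0 < τ.1 ∧ 0 < τ.2.2 ∧
      τ.1 ^ (-(1:ℝ)/2) * τ.2.1 * τ.2.2 ^ (-(1:ℝ)/p) = w},
    legendre3 (Phi p) τ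

/-- `Λ_p(t₁,t₂) = log ∫ exp(t₁ y + t₂|y|^p) μ_p(dy)`. -/
def LamP (p : ℝ) (t : ℝ × ℝ) : EReal :=
  ENNReal.log (∫⁻ y, ENNReal.ofReal (Real.exp (t.1 * y + t.2 * |y| ^ p)) ∂(muP p))

/-- `Ψ_{p,ν}(t₁,t₂) = ∫ Λ_p(t₁ u, t₂) ν(du)`. -/
def Psi (p : ℝ) (ν : Measure ℝ) (t : ℝ × ℝ) : EReal :=
  eIntegral ν (fun u => LamP p (t.1 * u, t.2))

/-- The quenched rate function `𝕀^q_{p,ν}`. -/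
def Iq (p : ℝ) (ν : Measure ℝ) (w : ℝ) : EReal :=
  ⨅ τ ∈ {τ : ℝ × ℝ | 0 < τ.2 ∧ τ.1 * τ.2 ^ (-(1:ℝ)/p) = w}, legendre2 (Psi p ν) τ

/-- The Cramér-type rate function `𝕀^{cr}_p`. -/
def Icr (p : ℝ) (w : ℝ) : EReal :=
  ⨅ τ ∈ {τ : ℝ × ℝ | 0 < τ.2 ∧ τ.1 * τ.2 ^ (-(1:ℝ)/p) = w}, legendre2 (LamP p) τ

/-- `Φ_γ(t₀,t₁) = log ∫∫ exp(t₀ z² + t₁ z x) μ₂(dz) γ(dx)`. -/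
def Phig (γ : Measure ℝ) (t : ℝ × ℝ) : EReal :=
  ENNReal.log (∫⁻ x, (∫⁻ z,
    ENNReal.ofReal (Real.exp (t.1 * z^2 + t.2 * z * x)) ∂(muP 2)) ∂γ)

/-- The annealed rate function `𝕀ᵃ_γ` for a product measure `γ^{⊗n}`. -/
def Iag (γ : Measure ℝ) (w : ℝ) : EReal :=
  ⨅ τ ∈ {τ : ℝ × ℝ | 0 < τ.1 ∧ τ.1 ^ (-(1:ℝ)/2) * τ.2 = w}, legendre2 (Phig γ) τ

/-- `Ψ_{γ,ν}(t) = ∫ log M_γ(t u) ν(du)`. -/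
def Psig (γ ν : Measure ℝ) (t : ℝ) : EReal := eIntegral ν (fun u => logM γ (t * u))

/-- The quenched rate function `𝕀^q_{γ,ν}` for a product measure. -/
def Iqg (γ ν : Measure ℝ) : ℝ → EReal := legendre1 (Psig γ ν)

/-- `Ψ_{∞,ν}`. -/
def PsiInf (ν : Measure ℝ) : ℝ → EReal := Psig muInf ν

/-- `𝕀^q_{∞,ν}`. -/
def IqInf (ν : Measure ℝ) : ℝ → EReal := legendre1 (PsiInf ν)

/-- `𝕀ᵃ_∞`. -/
def IaInf : ℝ → EReal := Iag muInf

/-- Euclidean inner product on `ℝⁿ`. -/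
def dotp {n : ℕ} (x y : Fin n → ℝ) : ℝ := ∑ i, x i * y i

/-- The unit ℓ^p ball of `ℝⁿ`. -/
def lpBall (n : ℕ) (p : ℝ) : Set (Fin n → ℝ) := {x | ∑ i, |x i| ^ p ≤ 1}

/-- The uniform probability measure on the unit ℓ^p ball. -/
def uniformLpBall (n : ℕ) (p : ℝ) : Measure (Fin n → ℝ) :=
  (volume (lpBall n p))⁻¹ • volume.restrict (lpBall n p)

/-- The unit Euclidean sphere in `ℝⁿ`. -/
def unitSphereSet (n : ℕ) : Set (Fin n → ℝ) := {x | ∑ i, (x i)^2 = 1}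

/-- `μ` is the (unique) rotation-invariant probability measure on the unit sphere `S^{n-1}`. -/
def IsUniformSphere {n : ℕ} (μ : Measure (Fin n → ℝ)) : Prop :=
  IsProbabilityMeasure μ ∧ μ (unitSphereSet n) = 1 ∧
    ∀ O : Matrix.orthogonalGroup (Fin n) ℝ,
      Measure.map (fun x => (O : Matrix (Fin n) (Fin n) ℝ).mulVec x) μ = μ

/-- A large deviation principle with speed `s` and rate function `I`. -/
def IsLDP {Ω : Type*} [MeasurableSpace Ω] (P : Measure Ω)
    (ξ : ℕ → Ω → ℝ) (s : ℕ → ℝ) (I : ℝ → EReal) : Prop :=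
  LowerSemicontinuous I ∧
    ∀ Γ : Set ℝ, MeasurableSet Γ →
      (-(⨅ x ∈ interior Γ, I x) ≤
        atTop.liminf fun n =>
          (((s n)⁻¹ : ℝ) : EReal) * ENNReal.log (P {ω | ξ n ω ∈ interior Γ})) ∧
      ((atTop.limsup fun n =>
          (((s n)⁻¹ : ℝ) : EReal) * ENNReal.log (P {ω | ξ n ω ∈ closure Γ})) ≤
        -(⨅ x ∈ closure Γ, I x))

/-- Goodness of a rate function: compact sublevel sets. -/
def HasCompactSublevels (I : ℝ → EReal) : Prop := ∀ c : ℝ, IsCompact {x | I x ≤ (c : EReal)}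

/-- Quasiconvexity: convex sublevel sets. -/
def QuasiconvexRate (I : ℝ → EReal) : Prop := ∀ c : EReal, Convex ℝ {x | I x ≤ c}

/-- Symmetry: `I(-w) = I(w)`. -/
def SymmetricRate (I : ℝ → EReal) : Prop := ∀ w : ℝ, I (-w) = I w

/-- Convexity of an extended-real-valued rate function. -/
def ConvexRate (I : ℝ → EReal) : Prop :=
  ∀ x y a b : ℝ, 0 ≤ a → 0 ≤ b → a + b = 1 →
    I (a * x + b * y) ≤ (a : EReal) * I x + (b : EReal) * I y

/-- Convexity on a set, for extended-real-valued functions. -/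
def ConvexOnE (s : Set ℝ) (g : ℝ → EReal) : Prop :=
  ∀ x ∈ s, ∀ y ∈ s, ∀ a b : ℝ, 0 ≤ a → 0 ≤ b → a + b = 1 →
    g (a * x + b * y) ≤ (a : EReal) * g x + (b : EReal) * g y

/-- Concavity on a set, for extended-real-valued functions. -/
def ConcaveOnE (s : Set ℝ) (g : ℝ → EReal) : Prop :=
  ∀ x ∈ s, ∀ y ∈ s, ∀ a b : ℝ, 0 ≤ a → 0 ≤ b → a + b = 1 →
    (a : EReal) * g x + (b : EReal) * g y ≤ g (a * x + b * y)

/-- Strict convexity, for extended-real-valued functions. -/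
def StrictConvexE (g : ℝ → EReal) : Prop :=
  ∀ x y : ℝ, x ≠ y → ∀ a b : ℝ, 0 < a → 0 < b → a + b = 1 →
    g (a * x + b * y) < (a : EReal) * g x + (b : EReal) * g y

/-- The property of agreeing with a real affine function on a set. -/
def AffineOnE (s : Set ℝ) (g : ℝ → EReal) : Prop :=
  ∃ m q : ℝ, ∀ t ∈ s, g t = ((m * t + q : ℝ) : EReal)

/-- Empirical measure `L_{n,θ} = (1/n) Σ δ_{√n θ_i}`. -/
def empMeas (n : ℕ) (θn : Fin n → ℝ) : Measure ℝ :=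
  ((n : ℝ≥0∞))⁻¹ • ∑ i : Fin n, Measure.dirac (Real.sqrt n * θn i)

end LDP

open LDP

section Cramer

variable {ι : Type*} [Fintype ι]

/-- The moment generating function of a measure on `ι → ℝ`, with values in `[0, ∞]`. -/
def vecMgf (ν : Measure (ι → ℝ)) (t : ι → ℝ) : ℝ≥0∞ :=
  ∫⁻ x, ENNReal.ofReal (Real.exp (t ⬝ᵥ x)) ∂ν

/-- The sublevel set `{Λ* ≤ c}` of the Legendre transform of the log moment generating function. -/
def cramerSublevel (ν : Measure (ι → ℝ)) (c : ℝ) : Set (ι → ℝ) :=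
  {τ | ∀ t, vecMgf ν t ≠ ⊤ → t ⬝ᵥ τ ≤ c + Real.log (vecMgf ν t).toReal}

/-- The empirical mean of `n` vectors. -/
def empMean {n : ℕ} (x : Fin n → ι → ℝ) : ι → ℝ := (n : ℝ)⁻¹ • ∑ i, x i

lemma continuous_dotProduct_right (t : ι → ℝ) : Continuous fun x : ι → ℝ => t ⬝ᵥ x := by
  unfold dotProduct; fun_prop

lemma continuous_dotProduct_left (x : ι → ℝ) : Continuous fun t : ι → ℝ => t ⬝ᵥ x := by
  unfold dotProduct; fun_prop

lemma measurable_empMean {ι : Type*} {n : ℕ} : Measurable (empMean : (Fin n → ι → ℝ) → ι → ℝ) := by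
  unfold empMean; fun_prop

lemma measurable_ofReal_exp_dotProduct (t : ι → ℝ) :
    Measurable fun x : ι → ℝ => ENNReal.ofReal (Real.exp (t ⬝ᵥ x)) := by
  have := (continuous_dotProduct_right t).measurable
  fun_prop

lemma natCast_mul_dotProduct_empMean {n : ℕ} (t : ι → ℝ) (x : Fin n → ι → ℝ) :
    (n : ℝ) * (t ⬝ᵥ empMean x) = ∑ i, t ⬝ᵥ x i := by
  rcases Nat.eq_zero_or_pos n with rfl | hn
  · simp
  · have : (n : ℝ) ≠ 0 := by positivity
    rw [empMean, dotProduct_smul, dotProduct_sum, smul_eq_mul]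
    field_simp

lemma lintegral_pi_prod_const {E : Type*} [MeasurableSpace E] (ν : Measure E)
    [IsProbabilityMeasure ν] {f : E → ℝ≥0∞} (hf : Measurable f) (n : ℕ) :
    ∫⁻ x, ∏ i, f (x i) ∂(Measure.pi fun _ : Fin n => ν) = (∫⁻ y, f y ∂ν) ^ n := by
  have h := lintegral_prod_eq_prod_lintegral_of_indepFun Finset.univ
    (fun (i : Fin n) (x : Fin n → E) => f (x i))
    (iIndepFun_pi (μ := fun _ : Fin n => ν) (X := fun _ => f) (fun _ => hf.aemeasurable))
    (fun i => hf.comp (measurable_pi_apply i))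
  rw [h]
  have : ∀ i : Fin n, ∫⁻ x, f (x i) ∂(Measure.pi fun _ : Fin n => ν) = ∫⁻ y, f y ∂ν := fun i =>
    (measurePreserving_eval (fun _ : Fin n => ν) i).lintegral_comp hf
  simp [this]

lemma vecMgf_pos (ν : Measure (ι → ℝ)) [NeZero ν] (t : ι → ℝ) : 0 < vecMgf ν t := by
  unfold vecMgf
  rw [lintegral_pos_iff_support (measurable_ofReal_exp_dotProduct t)]
  have : Function.support (fun x : ι → ℝ => ENNReal.ofReal (Real.exp (t ⬝ᵥ x))) = univ := by
    ext x; simp [Real.exp_pos]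
  rw [this]
  exact Measure.measure_univ_pos.2 (NeZero.ne ν)

lemma ofReal_exp_log_vecMgf (ν : Measure (ι → ℝ)) [NeZero ν] {t : ι → ℝ}
    (ht : vecMgf ν t ≠ ⊤) :
    ENNReal.ofReal (Real.exp (Real.log (vecMgf ν t).toReal)) = vecMgf ν t := by
  rw [Real.exp_log (ENNReal.toReal_pos (vecMgf_pos ν t).ne' ht), ENNReal.ofReal_toReal ht]

/-- Chernoff bound for the empirical mean. -/
lemma pi_le_dotProduct_empMean (ν : Measure (ι → ℝ)) [IsProbabilityMeasure ν] {t : ι → ℝ}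
    (ht : vecMgf ν t ≠ ⊤) (c : ℝ) (n : ℕ) :
    Measure.pi (fun _ : Fin n => ν)
      {x | c + Real.log (vecMgf ν t).toReal ≤ t ⬝ᵥ empMean x}
      ≤ ENNReal.ofReal (Real.exp (-(n * c))) := by
  set Z := vecMgf ν t with hZ
  have h0 : Z ^ n ≠ 0 := pow_ne_zero _ (vecMgf_pos ν t).ne'
  have h1 : Z ^ n ≠ ⊤ := ENNReal.pow_ne_top ht
  have hm := measurable_ofReal_exp_dotProduct t
  have hmark := mul_meas_ge_le_lintegral₀ (μ := Measure.pi (fun _ : Fin n => ν))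
    (f := fun x => ∏ i, ENNReal.ofReal (Real.exp (t ⬝ᵥ x i)))
    (Finset.measurable_prod _ fun i _ => hm.comp (measurable_pi_apply i)).aemeasurable
    (ENNReal.ofReal (Real.exp (n * c)) * Z ^ n)
  rw [lintegral_pi_prod_const ν hm n] at hmark
  change _ ≤ Z ^ n at hmark
  have hsub : {x : Fin n → ι → ℝ | c + Real.log Z.toReal ≤ t ⬝ᵥ empMean x} ⊆
      {x | ENNReal.ofReal (Real.exp (n * c)) * Z ^ n ≤
        ∏ i, ENNReal.ofReal (Real.exp (t ⬝ᵥ x i))} := by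
    intro x hx
    simp only [mem_ofPred_eq] at hx ⊢
    rw [hZ, ← ofReal_exp_log_vecMgf ν ht, ← ENNReal.ofReal_pow (Real.exp_pos _).le,
      ← ENNReal.ofReal_mul (Real.exp_pos _).le, ← ENNReal.ofReal_prod_of_nonneg
        (fun i _ => (Real.exp_pos _).le), ← Real.exp_nat_mul, ← Real.exp_add, ← Real.exp_sum,
        ← natCast_mul_dotProduct_empMean]
    apply ENNReal.ofReal_le_ofReal
    apply Real.exp_le_exp.2
    have := mul_le_mul_of_nonneg_left hx (Nat.cast_nonneg (α := ℝ) n)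
    linarith
  refine (measure_mono hsub).trans ?_
  revert hmark
  generalize (Measure.pi fun _ : Fin n => ν) _ = A
  intro hmark
  rw [mul_comm _ (Z ^ n), mul_assoc] at hmark
  have h2 := (ENNReal.mul_le_mul_iff_right h0 h1).1 (hmark.trans (mul_one (Z ^ n)).ge)
  rw [Real.exp_neg, ENNReal.ofReal_inv_of_pos (Real.exp_pos _)]
  rw [ENNReal.le_inv_iff_mul_le, mul_comm]
  exact h2

lemma isClosed_cramerSublevel (ν : Measure (ι → ℝ)) (c : ℝ) : IsClosed (cramerSublevel ν c) := by
  simp only [cramerSublevel, ofPred_forall]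
  exact isClosed_iInter fun t => isClosed_iInter fun _ =>
    isClosed_le (continuous_dotProduct_right t) continuous_const

lemma convex_cramerSublevel (ν : Measure (ι → ℝ)) (c : ℝ) : Convex ℝ (cramerSublevel ν c) := by
  intro x hx y hy a b ha hb hab t ht
  have h1 := mul_le_mul_of_nonneg_left (hx t ht) ha
  have h2 := mul_le_mul_of_nonneg_left (hy t ht) hb
  rw [dotProduct_add, dotProduct_smul, dotProduct_smul, smul_eq_mul, smul_eq_mul]
  have : a * (c + Real.log (vecMgf ν t).toReal) + b * (c + Real.log (vecMgf ν t).toReal)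
      = c + Real.log (vecMgf ν t).toReal := by rw [← add_mul, hab, one_mul]
  linarith

/-- The moment generating function is finite at small multiples of the coordinate vectors. -/
def HasExpMoments [DecidableEq ι] (ν : Measure (ι → ℝ)) : Prop :=
  ∃ δ > 0, ∀ i, vecMgf ν (Pi.single i δ) ≠ ⊤ ∧ vecMgf ν (Pi.single i (-δ)) ≠ ⊤

lemma exists_box [DecidableEq ι] {ν : Measure (ι → ℝ)} (h : HasExpMoments ν) (c : ℝ) :
    ∃ F : Finset (ι → ℝ), ∃ M : ℝ, (∀ t ∈ F, vecMgf ν t ≠ ⊤) ∧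
      ∀ τ : ι → ℝ, ¬ ‖τ‖ ≤ M → ∃ t ∈ F, c + Real.log (vecMgf ν t).toReal ≤ t ⬝ᵥ τ := by
  classical
  obtain ⟨δ, hδ, hfin⟩ := h
  set L : ι → ℝ := fun i => |c + Real.log (vecMgf ν (Pi.single i δ)).toReal| +
    |c + Real.log (vecMgf ν (Pi.single i (-δ))).toReal| with hL
  have hL0 : ∀ i, 0 ≤ L i := fun i => by positivity
  refine ⟨Finset.univ.image (fun i => Pi.single i δ) ∪
    Finset.univ.image (fun i => Pi.single i (-δ)), (∑ i, L i) / δ, ?_, ?_⟩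
  · intro t ht
    simp only [Finset.mem_union, Finset.mem_image, Finset.mem_univ, true_and] at ht
    rcases ht with ⟨i, rfl⟩ | ⟨i, rfl⟩
    exacts [(hfin i).1, (hfin i).2]
  · intro τ hτ
    have hM : 0 ≤ (∑ i, L i) / δ := div_nonneg (Finset.sum_nonneg fun i _ => hL0 i) hδ.le
    rw [pi_norm_le_iff_of_nonneg hM] at hτ
    push Not at hτ
    obtain ⟨i, hi⟩ := hτ
    rw [Real.norm_eq_abs, div_lt_iff₀ hδ] at hi
    have hLi : L i < |τ i| * δ :=
      (Finset.single_le_sum (fun i _ => hL0 i) (Finset.mem_univ i)).trans_lt hi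
    simp only [hL] at hLi
    have ha := le_abs_self (c + Real.log (vecMgf ν (Pi.single i δ)).toReal)
    have hb := le_abs_self (c + Real.log (vecMgf ν (Pi.single i (-δ))).toReal)
    have ha' := abs_nonneg (c + Real.log (vecMgf ν (Pi.single i δ)).toReal)
    have hb' := abs_nonneg (c + Real.log (vecMgf ν (Pi.single i (-δ))).toReal)
    rcases le_total 0 (τ i) with h0 | h0
    · refine ⟨Pi.single i δ, by simp, ?_⟩
      rw [single_dotProduct]
      rw [abs_of_nonneg h0] at hLi
      nlinarith
    · refine ⟨Pi.single i (-δ), by simp, ?_⟩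
      rw [single_dotProduct]
      rw [abs_of_nonpos h0] at hLi
      nlinarith

lemma isCompact_cramerSublevel [DecidableEq ι] {ν : Measure (ι → ℝ)} (h : HasExpMoments ν)
    (c : ℝ) : IsCompact (cramerSublevel ν c) := by
  obtain ⟨F, M, hF, hM⟩ := exists_box h (c + 1)
  refine Metric.isCompact_of_isClosed_isBounded (isClosed_cramerSublevel ν c) ?_
  refine (isBounded_iff_forall_norm_le).2 ⟨M, fun τ hτ => ?_⟩
  by_contra hcon
  obtain ⟨t, ht, h1⟩ := hM τ hcon
  have := hτ t (hF t ht)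
  linarith

/-- Large deviation upper bound for the empirical mean on closed sets. -/
lemma pi_empMean_mem_closed_le [DecidableEq ι] {ν : Measure (ι → ℝ)} [IsProbabilityMeasure ν]
    (h : HasExpMoments ν) {C : Set (ι → ℝ)} (hC : IsClosed C) {c : ℝ}
    (hdisj : Disjoint C (cramerSublevel ν c)) :
    ∃ K : ℕ, ∀ n : ℕ, Measure.pi (fun _ : Fin n => ν) {x | empMean x ∈ C}
      ≤ K * ENNReal.ofReal (Real.exp (-(n * c))) := by
  classical
  obtain ⟨F, M, hF, hM⟩ := exists_box h c
  have hpt : ∀ τ ∈ C ∩ Metric.closedBall 0 M, ∃ t, vecMgf ν t ≠ ⊤ ∧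
      c + Real.log (vecMgf ν t).toReal < t ⬝ᵥ τ := by
    intro τ hτ
    have h1 : τ ∉ cramerSublevel ν c := fun h => hdisj.ne_of_mem hτ.1 h rfl
    simpa [cramerSublevel] using h1
  have hcomp : IsCompact (C ∩ Metric.closedBall (0 : ι → ℝ) M) :=
    (isCompact_closedBall 0 M).inter_left hC
  choose! t ht1 ht2 using hpt
  obtain ⟨G, hG, hcov⟩ := hcomp.elim_nhds_subcover
    (fun τ => {τ' | c + Real.log (vecMgf ν (t τ)).toReal < t τ ⬝ᵥ τ'})
    (fun τ hτ => (isOpen_lt continuous_const (continuous_dotProduct_right _)).mem_nhds (ht2 τ hτ))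
  refine ⟨(F ∪ G.image t).card, fun n => ?_⟩
  have hsub : {x : Fin n → ι → ℝ | empMean x ∈ C} ⊆ ⋃ s ∈ F ∪ G.image t,
      {x | c + Real.log (vecMgf ν s).toReal ≤ s ⬝ᵥ empMean x} := by
    intro x hx
    simp only [mem_iUnion, mem_ofPred_eq, exists_prop]
    by_cases hxM : ‖empMean x‖ ≤ M
    · have := hcov ⟨hx, by simpa using hxM⟩
      simp only [mem_iUnion, mem_ofPred_eq, exists_prop] at this
      obtain ⟨τ, hτ, h2⟩ := this
      exact ⟨t τ, Finset.mem_union_right _ (Finset.mem_image_of_mem _ hτ), h2.le⟩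
    · obtain ⟨s, hs, h2⟩ := hM _ hxM
      exact ⟨s, Finset.mem_union_left _ hs, h2⟩
  refine (measure_mono hsub).trans ((measure_biUnion_finset_le _ _).trans ?_)
  rw [← nsmul_eq_mul]
  refine Finset.sum_le_card_nsmul _ _ _ fun s hs => ?_
  refine pi_le_dotProduct_empMean ν ?_ c n
  rcases Finset.mem_union.1 hs with hs | hs
  · exact hF s hs
  · obtain ⟨τ, hτ, rfl⟩ := Finset.mem_image.1 hs
    exact ht1 τ (hG τ hτ)

end Cramer

section PiMeasure

variable {E : Type*} [MeasurableSpace E]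

lemma lintegral_pi_fin_prod {n : ℕ} (μ : Measure E) [SigmaFinite μ] {f : Fin n → E → ℝ≥0∞}
    (hf : ∀ i, Measurable (f i)) :
    ∫⁻ x, ∏ i, f i (x i) ∂(Measure.pi fun _ : Fin n => μ) = ∏ i, ∫⁻ y, f i y ∂μ := by
  induction n with
  | zero => simp
  | succ n ih =>
    have hmp := (measurePreserving_piFinSuccAbove (fun _ : Fin (n + 1) => μ) 0).symm
    rw [← hmp.lintegral_comp_emb (MeasurableEquiv.measurableEmbedding _)]
    simp_rw [MeasurableEquiv.piFinSuccAbove_symm_apply, Fin.insertNthEquiv,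
      Fin.prod_univ_succ, Equiv.coe_fn_mk, Fin.insertNth_zero, Fin.cons_zero, Fin.cons_succ]
    have hm : Measurable fun x : Fin n → E => ∏ i : Fin n, f (Fin.succ i) (x i) :=
      Finset.measurable_prod _ fun i _ => (hf (Fin.succ i)).comp (measurable_pi_apply i)
    rw [← ih (f := fun i : Fin n => f (Fin.succ i)) (fun i : Fin n => hf (Fin.succ i)),
      ← lintegral_prod_mul (hf 0).aemeasurable hm.aemeasurable]
    rfl

lemma pi_withDensity_const {n : ℕ} (μ : Measure E) [SigmaFinite μ] {f : E → ℝ≥0∞}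
    (hf : Measurable f) [SigmaFinite (μ.withDensity f)] :
    Measure.pi (fun _ : Fin n => μ.withDensity f)
      = (Measure.pi fun _ : Fin n => μ).withDensity (fun x => ∏ i, f (x i)) := by
  refine Measure.pi_eq fun s hs => ?_
  rw [withDensity_apply _ (MeasurableSet.univ_pi hs), ← lintegral_indicator
    (MeasurableSet.univ_pi hs)]
  have : ∀ x : Fin n → E, (univ.pi s).indicator (fun x => ∏ i, f (x i)) x
      = ∏ i, (s i).indicator f (x i) := by
    intro x
    by_cases hx : x ∈ univ.pi s
    · rw [indicator_of_mem hx]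
      exact Finset.prod_congr rfl fun i _ => (indicator_of_mem (hx i (mem_univ i)) f).symm
    · rw [indicator_of_notMem hx]
      simp only [Set.mem_pi, mem_univ, true_imp_iff, not_forall] at hx
      obtain ⟨i, hi⟩ := hx
      exact (Finset.prod_eq_zero (Finset.mem_univ i) (indicator_of_notMem hi f)).symm
  simp_rw [this]
  rw [lintegral_pi_fin_prod μ fun i => hf.indicator (hs i)]
  refine Finset.prod_congr rfl fun i _ => ?_
  rw [withDensity_apply _ (hs i), lintegral_indicator (hs i)]

end PiMeasure

section CramerLower

variable {ι : Type*} [Fintype ι]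

/-- Weak law of large numbers for the empirical mean of square integrable vectors. -/
lemma eventually_half_le_pi_empMean (ν : Measure (ι → ℝ)) [IsProbabilityMeasure ν]
    (hL2 : ∀ i, MemLp (fun x : ι → ℝ => x i) 2 ν) {r : ℝ} (hr : 0 < r) :
    ∀ᶠ n : ℕ in atTop, (1 / 2 : ℝ≥0∞) ≤ Measure.pi (fun _ : Fin n => ν)
      {x | ‖empMean x - fun i => ∫ y, y i ∂ν‖ < r} := by
  set m : ι → ℝ := fun i => ∫ y, y i ∂ν with hm
  have hbound : ∀ n : ℕ, 0 < n → Measure.pi (fun _ : Fin n => ν)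
      {x | ‖empMean x - m‖ < r}ᶜ ≤
      ENNReal.ofReal ((∑ i, Var[fun x : ι → ℝ => x i; ν] / r ^ 2) / n) := by
    intro n hn
    have hn' : (0 : ℝ) < n := by positivity
    have hsub : {x : Fin n → ι → ℝ | ‖empMean x - m‖ < r}ᶜ ⊆
        ⋃ i : ι, {x | n * r ≤ |(∑ j : Fin n, fun x : Fin n → ι → ℝ => x j i) x -
          ∫ x, (∑ j : Fin n, fun x : Fin n → ι → ℝ => x j i) x
            ∂(Measure.pi (fun _ : Fin n => ν))|} := by
      intro x hx
      simp only [mem_compl_iff, mem_ofPred_eq] at hx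
      rw [pi_norm_lt_iff hr] at hx
      push Not at hx
      obtain ⟨i, hi⟩ := hx
      refine mem_iUnion.2 ⟨i, ?_⟩
      have hmi : ∫ x, (∑ j : Fin n, fun x : Fin n → ι → ℝ => x j i) x
            ∂(Measure.pi (fun _ : Fin n => ν)) = n * m i := by
        simp only [Finset.sum_apply]
        have hmp := fun j : Fin n => measurePreserving_eval (fun _ : Fin n => ν) j
        rw [integral_finsetSum _ fun j _ => ?_]
        · have : ∀ j : Fin n, ∫ x, x j i ∂(Measure.pi (fun _ : Fin n => ν)) = m i := by
            intro j
            rw [hm]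
            simp only
            conv_rhs => rw [← (hmp j).map_eq]
            rw [integral_map (hmp j).measurable.aemeasurable
              (measurable_pi_apply i).aestronglyMeasurable]
          simp [this]
        · exact (hmp j).integrable_comp_of_integrable ((hL2 i).integrable (by norm_num))
      simp only [mem_ofPred_eq]
      rw [hmi]
      simp only [Finset.sum_apply]
      have h1 : ∑ j, x j i - n * m i = n * (empMean x - m) i := by
        simp only [empMean, Pi.sub_apply, Pi.smul_apply, Finset.sum_apply, smul_eq_mul]
        field_simp
      rw [h1, abs_mul, abs_of_pos hn']
      exact mul_le_mul_of_nonneg_left hi hn'.le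
    refine (measure_mono hsub).trans ((measure_iUnion_fintype_le _ _).trans ?_)
    rw [Finset.sum_div, ENNReal.ofReal_sum_of_nonneg fun i _ => by
      have := variance_nonneg (fun x : ι → ℝ => x i) ν
      positivity]
    refine Finset.sum_le_sum fun i _ => ?_
    have hmem : MemLp (∑ j : Fin n, fun x : Fin n → ι → ℝ => x j i) 2
        (Measure.pi (fun _ : Fin n => ν)) := by
      refine memLp_finsetSum' _ fun j _ => ?_
      exact (hL2 i).comp_measurePreserving (measurePreserving_eval (fun _ : Fin n => ν) j)
    refine (meas_ge_le_variance_div_sq hmem (by positivity : 0 < n * r)).trans ?_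
    rw [variance_sum_pi (μ := fun _ : Fin n => ν) (X := fun _ x => x i) fun _ => hL2 i]
    apply ENNReal.ofReal_le_ofReal
    simp only [Finset.sum_const, Finset.card_univ, Fintype.card_fin, nsmul_eq_mul]
    apply le_of_eq
    field_simp
  have hlim : Tendsto (fun n : ℕ => ENNReal.ofReal
      ((∑ i, Var[fun x : ι → ℝ => x i; ν] / r ^ 2) / n)) atTop (𝓝 0) := by
    rw [← ENNReal.ofReal_zero]
    exact ENNReal.tendsto_ofReal (tendsto_const_div_atTop_nhds_zero_nat _)
  have hev := hlim.eventually_le_const (show (0 : ℝ≥0∞) < 1 / 2 by norm_num)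
  filter_upwards [hev, eventually_gt_atTop 0] with n h1 h2
  have hmeas : MeasurableSet {x : Fin n → ι → ℝ | ‖empMean x - m‖ < r} :=
    measurableSet_lt ((measurable_empMean.sub_const m).norm) measurable_const
  have h3 := (hbound n h2).trans h1
  rw [prob_compl_eq_one_sub hmeas, tsub_le_iff_right] at h3
  have h4 : (1 / 2 : ℝ≥0∞) + 1 / 2 ≤ 1 / 2 + Measure.pi (fun _ : Fin n => ν)
      {x | ‖empMean x - m‖ < r} := by
    rw [ENNReal.add_halves]; exact h3
  exact (ENNReal.add_le_add_iff_left (by norm_num)).1 h4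

lemma abs_dotProduct_le (t x : ι → ℝ) : |t ⬝ᵥ x| ≤ (∑ i, |t i|) * ‖x‖ := by
  rw [Finset.sum_mul]
  refine (Finset.abs_sum_le_sum_abs _ _).trans (Finset.sum_le_sum fun i _ => ?_)
  rw [abs_mul]
  exact mul_le_mul_of_nonneg_left (norm_le_pi_norm x i) (abs_nonneg _)

/-- Lower bound for the empirical mean by an exponential change of measure. -/
lemma eventually_le_pi_empMean_of_tilt (ν : Measure (ι → ℝ)) [IsProbabilityMeasure ν]
    {g : (ι → ℝ) → ℝ≥0∞} (hg : Measurable g) [IsProbabilityMeasure (ν.withDensity g)]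
    (hL2 : ∀ i, MemLp (fun x : ι → ℝ => x i) 2 (ν.withDensity g)) {t : ι → ℝ} {a : ℝ}
    (hgt : ∀ x, g x ≤ ENNReal.ofReal (Real.exp (t ⬝ᵥ x - a))) {m : ι → ℝ}
    (hm : ∀ i, m i = ∫ y, y i ∂(ν.withDensity g)) {r : ℝ} (hr : 0 < r) :
    ∀ᶠ n : ℕ in atTop, ENNReal.ofReal
        (1 / 2 * Real.exp (-(n * (t ⬝ᵥ m - a + (∑ i, |t i|) * r)))) ≤
      Measure.pi (fun _ : Fin n => ν) {x | ‖empMean x - m‖ < r} := by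
  have hm' : m = fun i => ∫ y, y i ∂(ν.withDensity g) := funext hm
  filter_upwards [eventually_half_le_pi_empMean (ν.withDensity g) hL2 hr] with n hn
  rw [← hm'] at hn
  set A := {x : Fin n → ι → ℝ | ‖empMean x - m‖ < r} with hA
  have hmeas : MeasurableSet A :=
    measurableSet_lt ((measurable_empMean.sub_const m).norm) measurable_const
  rw [pi_withDensity_const ν hg, withDensity_apply _ hmeas] at hn
  set b := n * (t ⬝ᵥ m - a + (∑ i, |t i|) * r) with hb
  have hle : ∫⁻ x in A, ∏ i, g (x i) ∂(Measure.pi fun _ : Fin n => ν) ≤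
      ENNReal.ofReal (Real.exp b) * Measure.pi (fun _ : Fin n => ν) A := by
    rw [← setLIntegral_const]
    refine setLIntegral_mono measurable_const fun x hx => ?_
    refine (Finset.prod_le_prod' fun i _ => hgt (x i)).trans ?_
    rw [← ENNReal.ofReal_prod_of_nonneg (fun i _ => (Real.exp_pos _).le), ← Real.exp_sum]
    apply ENNReal.ofReal_le_ofReal
    apply Real.exp_le_exp.2
    rw [Finset.sum_sub_distrib, ← natCast_mul_dotProduct_empMean, hb]
    simp only [Finset.sum_const, Finset.card_univ, Fintype.card_fin, nsmul_eq_mul]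
    rw [← mul_sub]
    refine mul_le_mul_of_nonneg_left ?_ (Nat.cast_nonneg n)
    have h1 : t ⬝ᵥ empMean x - t ⬝ᵥ m ≤ (∑ i, |t i|) * r := by
      rw [← dotProduct_sub]
      refine (le_abs_self _).trans ((abs_dotProduct_le _ _).trans ?_)
      exact mul_le_mul_of_nonneg_left (le_of_lt hx) (Finset.sum_nonneg fun i _ => abs_nonneg _)
    linarith
  have h2 := hn.trans hle
  have hpos : ENNReal.ofReal (Real.exp b) ≠ 0 := by simp [Real.exp_pos]
  rw [Real.exp_neg, ENNReal.ofReal_mul (by norm_num), ENNReal.ofReal_inv_of_pos (Real.exp_pos _),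
    ← div_eq_mul_inv]
  refine ENNReal.div_le_of_le_mul ?_
  rw [mul_comm]
  refine le_trans (le_of_eq ?_) h2
  rw [ENNReal.ofReal_div_of_pos (by norm_num)]
  simp

end CramerLower

section Tilt

variable {ι : Type*} [Fintype ι] {κ : Measure (ι → ℝ)} [IsFiniteMeasure κ] {M : ℝ}

lemma measurable_exp_dotProduct (t : ι → ℝ) :
    Measurable fun x : ι → ℝ => Real.exp (t ⬝ᵥ x) :=
  Real.measurable_exp.comp (continuous_dotProduct_right t).measurable

lemma dotProduct_le_of_norm_le (t : ι → ℝ) {x : ι → ℝ} (hx : ‖x‖ ≤ M) :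
    |t ⬝ᵥ x| ≤ (∑ i, |t i|) * M :=
  (abs_dotProduct_le t x).trans
    (mul_le_mul_of_nonneg_left hx (Finset.sum_nonneg fun _ _ => abs_nonneg _))

lemma integrable_exp_dotProduct (hM : ∀ᵐ x ∂κ, ‖x‖ ≤ M) (t : ι → ℝ) :
    Integrable (fun x => Real.exp (t ⬝ᵥ x)) κ := by
  refine Integrable.of_bound (measurable_exp_dotProduct t).aestronglyMeasurable
    (Real.exp ((∑ i, |t i|) * M)) ?_
  filter_upwards [hM] with x hx
  rw [Real.norm_eq_abs, Real.abs_exp]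
  exact Real.exp_le_exp.2 ((le_abs_self _).trans (dotProduct_le_of_norm_le t hx))

lemma le_integral_exp_dotProduct (hM : ∀ᵐ x ∂κ, ‖x‖ ≤ M) (t : ι → ℝ) :
    κ.real univ * Real.exp (-((∑ i, |t i|) * M)) ≤ ∫ x, Real.exp (t ⬝ᵥ x) ∂κ := by
  rw [← smul_eq_mul, ← integral_const]
  refine integral_mono_ae (integrable_const _) (integrable_exp_dotProduct hM t) ?_
  filter_upwards [hM] with x hx
  exact Real.exp_le_exp.2 (neg_le_of_abs_le (dotProduct_le_of_norm_le t hx))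

lemma integral_exp_dotProduct_pos [NeZero κ] (hM : ∀ᵐ x ∂κ, ‖x‖ ≤ M) (t : ι → ℝ) :
    0 < ∫ x, Real.exp (t ⬝ᵥ x) ∂κ :=
  lt_of_lt_of_le (mul_pos measureReal_univ_pos (Real.exp_pos _)) (le_integral_exp_dotProduct hM t)

lemma continuous_integral_exp_dotProduct (hM : ∀ᵐ x ∂κ, ‖x‖ ≤ M) :
    Continuous fun t : ι → ℝ => ∫ x, Real.exp (t ⬝ᵥ x) ∂κ := by
  rw [continuous_iff_continuousAt]
  intro t
  have hc : Continuous fun s : ι → ℝ => ∑ i, |s i| := by fun_prop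
  have hev : ∀ᶠ s in 𝓝 t, ∑ i, |s i| < (∑ i, |t i|) + 1 :=
    hc.continuousAt.eventually_lt continuousAt_const (lt_add_one _)
  refine continuousAt_of_dominated (bound := fun _ => Real.exp (((∑ i, |t i|) + 1) * |M|))
    (Eventually.of_forall fun s => (measurable_exp_dotProduct s).aestronglyMeasurable) ?_
    (integrable_const _) ?_
  · filter_upwards [hev] with s hs
    filter_upwards [hM] with x hx
    rw [Real.norm_eq_abs, Real.abs_exp]
    refine Real.exp_le_exp.2 ((le_abs_self _).trans ((abs_dotProduct_le s x).trans ?_))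
    exact mul_le_mul hs.le (hx.trans (le_abs_self M)) (norm_nonneg _)
      ((Finset.sum_nonneg fun _ _ => abs_nonneg _).trans hs.le)
  · exact Eventually.of_forall fun x =>
      (Real.continuous_exp.comp (continuous_dotProduct_left x)).continuousAt

lemma hasDerivAt_integral_exp_dotProduct [DecidableEq ι] (hM : ∀ᵐ x ∂κ, ‖x‖ ≤ M) (t : ι → ℝ)
    (i : ι) :
    HasDerivAt (fun s : ℝ => ∫ x, Real.exp ((t + s • Pi.single i 1) ⬝ᵥ x) ∂κ)
      (∫ x, x i * Real.exp (t ⬝ᵥ x) ∂κ) 0 := by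
  have key := hasDerivAt_integral_of_dominated_loc_of_deriv_le (μ := κ)
    (F := fun (s : ℝ) x => Real.exp ((t + s • Pi.single i 1) ⬝ᵥ x))
    (F' := fun (s : ℝ) x => x i * Real.exp ((t + s • Pi.single i 1) ⬝ᵥ x))
    (x₀ := (0 : ℝ)) (s := Metric.ball 0 1)
    (bound := fun _ => |M| * Real.exp ((∑ j, |t j|) * |M| + |M|))
    (Metric.ball_mem_nhds _ one_pos)
    (Eventually.of_forall fun s =>
      (measurable_exp_dotProduct (t + s • Pi.single i 1)).aestronglyMeasurable)
    (integrable_exp_dotProduct hM (t + (0 : ℝ) • Pi.single i 1))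
    (((measurable_pi_apply i).mul
      (measurable_exp_dotProduct (t + (0 : ℝ) • Pi.single i 1))).aestronglyMeasurable) ?_
    (integrable_const _) ?_
  · simpa using key.2
  · filter_upwards [hM] with x hx s hs
    have hxM := hx.trans (le_abs_self M)
    have hxi : |x i| ≤ |M| := (norm_le_pi_norm x i).trans hxM
    rw [Real.norm_eq_abs, abs_mul, Real.abs_exp]
    refine mul_le_mul hxi (Real.exp_le_exp.2 ?_) (Real.exp_pos _).le (abs_nonneg _)
    rw [add_dotProduct, smul_dotProduct, single_one_dotProduct, smul_eq_mul]
    have h1 := (le_abs_self _).trans (dotProduct_le_of_norm_le t hxM)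
    have h2 : s * x i ≤ |M| := by
      refine (le_abs_self _).trans ?_
      rw [abs_mul]
      have : |s| ≤ 1 := by
        have := Metric.mem_ball.1 hs
        rw [dist_zero_right, Real.norm_eq_abs] at this
        exact this.le
      calc |s| * |x i| ≤ 1 * |M| := mul_le_mul this hxi (abs_nonneg _) zero_le_one
        _ = |M| := one_mul _
    linarith
  · refine Eventually.of_forall fun x s _ => ?_
    have : ∀ s : ℝ, (t + s • Pi.single i 1) ⬝ᵥ x = t ⬝ᵥ x + s * x i := fun s => by
      rw [add_dotProduct, smul_dotProduct, single_one_dotProduct, smul_eq_mul]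
    simp_rw [this]
    have h := ((hasDerivAt_id s).mul_const (x i)).const_add (t ⬝ᵥ x)
    have h2 := h.exp
    simp only [id, one_mul] at h2
    rw [mul_comm]
    exact h2

lemma norm_sq_le_dotProduct_self (t : ι → ℝ) : ‖t‖ ^ 2 ≤ t ⬝ᵥ t := by
  have h0 : 0 ≤ t ⬝ᵥ t := Finset.sum_nonneg fun i _ => mul_self_nonneg (t i)
  have : ‖t‖ ≤ √(t ⬝ᵥ t) := by
    refine (pi_norm_le_iff_of_nonneg (Real.sqrt_nonneg _)).2 fun i => ?_
    refine Real.abs_le_sqrt ?_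
    rw [sq]
    exact Finset.single_le_sum (f := fun i => t i * t i) (fun i _ => mul_self_nonneg (t i))
      (Finset.mem_univ i)
  calc ‖t‖ ^ 2 ≤ √(t ⬝ᵥ t) ^ 2 := pow_le_pow_left₀ (norm_nonneg _) this 2
    _ = t ⬝ᵥ t := Real.sq_sqrt h0

lemma sum_abs_le (t : ι → ℝ) : ∑ i, |t i| ≤ Fintype.card ι * ‖t‖ := by
  have := Finset.sum_le_card_nsmul Finset.univ (fun i => |t i|) ‖t‖
    fun i _ => norm_le_pi_norm t i
  simpa using this

/-- Lower bound for the regularised Legendre functional. -/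
lemma le_log_integral_exp_sub [NeZero κ] (hM : ∀ᵐ x ∂κ, ‖x‖ ≤ M) (hM0 : 0 ≤ M) (t τ : ι → ℝ)
    {ε : ℝ} (hε : 0 < ε) :
    Real.log (κ.real univ) - Fintype.card ι * (M + ‖τ‖) * ‖t‖ + ε * ‖t‖ ^ 2 ≤
      Real.log (∫ x, Real.exp (t ⬝ᵥ x) ∂κ) - t ⬝ᵥ τ + ε * (t ⬝ᵥ t) := by
  have h1 := Real.log_le_log (mul_pos measureReal_univ_pos (Real.exp_pos _))
    (le_integral_exp_dotProduct hM t)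
  rw [Real.log_mul measureReal_univ_pos.ne' (Real.exp_pos _).ne', Real.log_exp] at h1
  have h2 := (le_abs_self _).trans (abs_dotProduct_le t τ)
  have h3 := mul_le_mul_of_nonneg_left (norm_sq_le_dotProduct_self t) hε.le
  have h4 := mul_le_mul_of_nonneg_right (sum_abs_le t) hM0
  have h5 := mul_le_mul_of_nonneg_right (sum_abs_le t) (norm_nonneg τ)
  nlinarith

lemma exists_isMin_log_integral_exp [NeZero κ] (hM : ∀ᵐ x ∂κ, ‖x‖ ≤ M) (hM0 : 0 ≤ M)
    (τ : ι → ℝ) {ε : ℝ} (hε : 0 < ε) :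
    ∃ t : ι → ℝ, (∀ s : ι → ℝ,
      Real.log (∫ x, Real.exp (t ⬝ᵥ x) ∂κ) - t ⬝ᵥ τ + ε * (t ⬝ᵥ t) ≤
      Real.log (∫ x, Real.exp (s ⬝ᵥ x) ∂κ) - s ⬝ᵥ τ + ε * (s ⬝ᵥ s)) ∧
      ∀ i, ∫ x, x i * Real.exp (t ⬝ᵥ x) ∂κ =
        (τ i - 2 * ε * t i) * ∫ x, Real.exp (t ⬝ᵥ x) ∂κ := by
  classical
  set F : (ι → ℝ) → ℝ := fun t =>
    Real.log (∫ x, Real.exp (t ⬝ᵥ x) ∂κ) - t ⬝ᵥ τ + ε * (t ⬝ᵥ t) with hF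
  have hcont : Continuous F := by
    have h1 := (continuous_integral_exp_dotProduct hM).log
      fun t => (integral_exp_dotProduct_pos hM t).ne'
    have h2 := continuous_dotProduct_left τ
    have h3 : Continuous fun t : ι → ℝ => t ⬝ᵥ t := by unfold dotProduct; fun_prop
    exact (h1.sub h2).add (continuous_const.mul h3)
  have htend : Tendsto F (cocompact (ι → ℝ)) atTop := by
    refine tendsto_atTop_mono (fun t => le_log_integral_exp_sub hM hM0 t τ hε) ?_
    have hq : Tendsto (fun r : ℝ => r * (ε * r - Fintype.card ι * (M + ‖τ‖)) +
        Real.log (κ.real univ)) atTop atTop := by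
      refine tendsto_atTop_add_const_right _ _ (tendsto_id.atTop_mul_atTop₀ ?_)
      exact tendsto_atTop_add_const_right _ _ (tendsto_id.const_mul_atTop hε)
    refine (hq.comp (tendsto_norm_cocompact_atTop (E := ι → ℝ))).congr fun t => ?_
    simp only [Function.comp]
    ring
  obtain ⟨t, ht⟩ := hcont.exists_forall_le htend
  refine ⟨t, ht, fun i => ?_⟩
  set z := ∫ x, Real.exp (t ⬝ᵥ x) ∂κ with hz
  have hzpos : 0 < z := integral_exp_dotProduct_pos hM t
  have hd1 := (hasDerivAt_integral_exp_dotProduct hM t i).log (by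
    simpa using (integral_exp_dotProduct_pos hM t).ne')
  have hd2 : HasDerivAt (fun s : ℝ => (t + s • Pi.single i 1) ⬝ᵥ τ) (τ i) 0 := by
    have : ∀ s : ℝ, (t + s • Pi.single i 1) ⬝ᵥ τ = t ⬝ᵥ τ + s * τ i := fun s => by
      rw [add_dotProduct, smul_dotProduct, single_one_dotProduct, smul_eq_mul]
    simp_rw [this]
    simpa using ((hasDerivAt_id (0 : ℝ)).mul_const (τ i)).const_add (t ⬝ᵥ τ)
  have hd3 : HasDerivAt (fun s : ℝ => ε * ((t + s • Pi.single i 1) ⬝ᵥ (t + s • Pi.single i 1)))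
      (ε * (2 * t i)) 0 := by
    have : ∀ s : ℝ, (t + s • Pi.single i 1) ⬝ᵥ (t + s • Pi.single i 1)
        = t ⬝ᵥ t + s * (2 * t i) + s ^ 2 := fun s => by
      simp only [add_dotProduct, dotProduct_add, smul_dotProduct, dotProduct_smul,
        single_one_dotProduct, dotProduct_single_one, smul_eq_mul, Pi.add_apply, Pi.smul_apply,
        Pi.single_eq_same]
      ring
    simp_rw [this]
    have h := (((hasDerivAt_id (0 : ℝ)).mul_const (2 * t i)).const_add (t ⬝ᵥ t)).add
      (hasDerivAt_pow 2 (0 : ℝ))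
    simpa using h.const_mul ε
  have hmin : IsLocalMin (fun s : ℝ => F (t + s • Pi.single i 1)) 0 := by
    refine Eventually.of_forall fun s => ?_
    simpa using ht (t + s • Pi.single i 1)
  have h0 := hmin.hasDerivAt_eq_zero ((hd1.sub hd2).add hd3)
  simp only [zero_smul, add_zero] at h0
  rw [← hz] at h0
  have : (∫ x, x i * Real.exp (t ⬝ᵥ x) ∂κ) / z = τ i - 2 * ε * t i := by linarith
  rw [← this]
  field_simp

end Tilt

section CramerLowerBound

variable {ι : Type*} [Fintype ι]

lemma ae_restrict_closedBall_norm_le (ν : Measure (ι → ℝ)) (M : ℝ) :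
    ∀ᵐ x ∂(ν.restrict (Metric.closedBall 0 M)), ‖x‖ ≤ M := by
  filter_upwards [ae_restrict_mem measurableSet_closedBall] with x hx
  simpa using hx

/-- Existence of an exponential tilt of a truncation of `ν` whose mean is close to `τ`. -/
lemma exists_tilt_of_mem_cramerSublevel (ν : Measure (ι → ℝ)) [IsProbabilityMeasure ν]
    {c : ℝ} {τ : ι → ℝ} (hτ : τ ∈ cramerSublevel ν c) {ε η : ℝ} (hε : 0 < ε) (hη : 0 < η) :
    ∃ (k : ℕ) (t : ι → ℝ), ν (Metric.closedBall 0 k) ≠ 0 ∧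
      (∀ i, ∫ x in Metric.closedBall 0 k, x i * Real.exp (t ⬝ᵥ x) ∂ν =
        (τ i - 2 * ε * t i) * ∫ x in Metric.closedBall 0 k, Real.exp (t ⬝ᵥ x) ∂ν) ∧
      -c - η < Real.log (∫ x in Metric.closedBall 0 k, Real.exp (t ⬝ᵥ x) ∂ν) - t ⬝ᵥ τ ∧
      Real.log (∫ x in Metric.closedBall 0 k, Real.exp (t ⬝ᵥ x) ∂ν) - t ⬝ᵥ τ
        + ε * (t ⬝ᵥ t) ≤ 0 := by
  have hU : ⋃ k : ℕ, Metric.closedBall (0 : ι → ℝ) (k : ℝ) = univ :=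
    Metric.iUnion_closedBall_nat 0
  obtain ⟨k0, hk0⟩ : ∃ k : ℕ, ν (Metric.closedBall 0 k) ≠ 0 := by
    by_contra! h
    have := measure_iUnion_null h
    rw [hU] at this
    simp at this
  have hne : ∀ k : ℕ, k0 ≤ k → ν (Metric.closedBall 0 k) ≠ 0 := fun k hk h =>
    hk0 (measure_mono_null (Metric.closedBall_subset_closedBall (by exact_mod_cast hk)) h)
  set z : ℕ → (ι → ℝ) → ℝ := fun k t => ∫ x in Metric.closedBall 0 k, Real.exp (t ⬝ᵥ x) ∂ν with hz
  have hM := fun k : ℕ => ae_restrict_closedBall_norm_le ν (k : ℝ)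
  have hnz : ∀ k : ℕ, k0 ≤ k → NeZero (ν.restrict (Metric.closedBall 0 (k : ℝ))) := fun k hk =>
    ⟨fun h => hne k hk (Measure.restrict_eq_zero.1 h)⟩
  have hzpos : ∀ k, k0 ≤ k → ∀ t, 0 < z k t := fun k hk t => by
    have := hnz k hk
    exact integral_exp_dotProduct_pos (hM k) t
  have hzmono : ∀ j k, k0 ≤ j → j ≤ k → ∀ t, z j t ≤ z k t := fun j k _ hjk t => by
    refine setIntegral_mono_set (integrable_exp_dotProduct (hM k) t)
      (Eventually.of_forall fun x => (Real.exp_pos _).le) ?_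
    exact (Metric.closedBall_subset_closedBall (by exact_mod_cast hjk)).eventuallyLE
  by_contra! hcon
  have hmin : ∀ k : ℕ, k0 ≤ k → ∃ t : ι → ℝ, Real.log (z k t) - t ⬝ᵥ τ ≤ -c - η ∧
      Real.log (z k t) - t ⬝ᵥ τ + ε * (t ⬝ᵥ t) ≤ 0 := by
    intro k hk
    have := hnz k hk
    obtain ⟨t, h1, h2⟩ := exists_isMin_log_integral_exp (hM k) (Nat.cast_nonneg k) τ hε
    have h3 : Real.log (z k t) - t ⬝ᵥ τ + ε * (t ⬝ᵥ t) ≤ 0 := by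
      refine (h1 0).trans ?_
      simp only [zero_dotProduct, Real.exp_zero, mul_zero, sub_zero, add_zero]
      refine Real.log_nonpos (integral_nonneg fun _ => zero_le_one) ?_
      simp only [integral_const, smul_eq_mul, mul_one, measureReal_def]
      refine ENNReal.toReal_le_of_le_ofReal zero_le_one ?_
      simpa using prob_le_one
    refine ⟨t, ?_, h3⟩
    by_contra! h4
    exact absurd h3 (not_le.2 (hcon k t (hne k hk) h2 h4))
  have := hnz k0 le_rfl
  set b := Real.log ((ν.restrict (Metric.closedBall 0 (k0 : ℝ))).real univ) with hb
  set D := Fintype.card ι * ((k0 : ℝ) + ‖τ‖) with hD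
  have hD0 : 0 ≤ D := by positivity
  set R := (D + |b|) / ε + 1 with hR
  have hbd : ∀ k, k0 ≤ k → ∀ t : ι → ℝ, Real.log (z k t) - t ⬝ᵥ τ + ε * (t ⬝ᵥ t) ≤ 0 →
      ‖t‖ ≤ R := by
    intro k hk t ht
    by_contra! hlt
    have h1 := le_log_integral_exp_sub (hM k0) (Nat.cast_nonneg k0) t τ hε
    have h2 := Real.log_le_log (hzpos k0 le_rfl t) (hzmono k0 k le_rfl hk t)
    have h3 : b - D * ‖t‖ + ε * ‖t‖ ^ 2 ≤ 0 := by
      refine le_trans h1 (le_trans ?_ ht)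
      linarith
    have h4 : D + |b| + ε < ε * ‖t‖ := by
      have := mul_lt_mul_of_pos_left hlt hε
      rw [hR, mul_add, mul_div_cancel₀ _ hε.ne', mul_one] at this
      exact this
    have h5 : 1 ≤ ‖t‖ := by
      have : 0 ≤ (D + |b|) / ε := by positivity
      linarith
    have h6 := neg_abs_le b
    have h7 : (D + |b| + ε) * ‖t‖ ≤ ε * ‖t‖ * ‖t‖ :=
      mul_le_mul_of_nonneg_right h4.le (norm_nonneg t)
    have h8 : |b| ≤ |b| * ‖t‖ := le_mul_of_one_le_right (abs_nonneg b) h5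
    nlinarith
  set K : ℕ → Set (ι → ℝ) := fun k =>
    Metric.closedBall 0 R ∩ {t | Real.log (z (k0 + k) t) - t ⬝ᵥ τ ≤ -c - η} with hK
  have hclosed : ∀ k, IsClosed {t | Real.log (z (k0 + k) t) - t ⬝ᵥ τ ≤ -c - η} := fun k => by
    have h1 := (continuous_integral_exp_dotProduct (hM (k0 + k))).log
      fun t => (hzpos (k0 + k) (Nat.le_add_right _ _) t).ne'
    exact isClosed_le (h1.sub (continuous_dotProduct_left τ)) continuous_const
  obtain ⟨t, ht⟩ : (⋂ k, K k).Nonempty := by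
    refine IsCompact.nonempty_iInter_of_sequence_nonempty_isCompact_isClosed K ?_ ?_ ?_ ?_
    · intro k t ht
      have ht2 : Real.log (z (k0 + (k + 1)) t) - t ⬝ᵥ τ ≤ -c - η := ht.2
      refine ⟨ht.1, le_trans (b := Real.log (z (k0 + (k + 1)) t) - t ⬝ᵥ τ) ?_ ht2⟩
      have := Real.log_le_log (hzpos (k0 + k) (Nat.le_add_right _ _) t)
        (hzmono (k0 + k) (k0 + (k + 1)) (Nat.le_add_right _ _) (by omega) t)
      linarith
    · intro k
      obtain ⟨t, h1, h2⟩ := hmin (k0 + k) (Nat.le_add_right _ _)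
      exact ⟨t, by simpa using hbd _ (Nat.le_add_right _ _) t h2, h1⟩
    · exact (isCompact_closedBall _ _).inter_right (hclosed 0)
    · exact fun k => Metric.isClosed_closedBall.inter (hclosed k)
  have hle : vecMgf ν t ≤ ENNReal.ofReal (Real.exp (t ⬝ᵥ τ - c - η)) := by
    have hU' : ⋃ k : ℕ, Metric.closedBall (0 : ι → ℝ) ((k0 + k : ℕ) : ℝ) = univ := by
      refine eq_univ_of_univ_subset (hU ▸ iUnion_mono fun k => ?_)
      exact Metric.closedBall_subset_closedBall
        (by push_cast; linarith [Nat.cast_nonneg (α := ℝ) k0])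
    unfold vecMgf
    rw [← setLIntegral_univ, ← hU', setLIntegral_iUnion_of_directed]
    · refine iSup_le fun k => ?_
      have hk := (mem_iInter.1 ht k).2
      rw [← ofReal_integral_eq_lintegral_ofReal (integrable_exp_dotProduct (hM (k0 + k)) t)
        (Eventually.of_forall fun x => (Real.exp_pos _).le)]
      apply ENNReal.ofReal_le_ofReal
      refine (Real.log_le_iff_le_exp (hzpos (k0 + k) (Nat.le_add_right _ _) t)).1 ?_
      have hk' : Real.log (z (k0 + k) t) - t ⬝ᵥ τ ≤ -c - η := hk
      linarith
    · refine Monotone.directed_le fun i j hij => ?_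
      exact Metric.closedBall_subset_closedBall (by exact_mod_cast Nat.add_le_add_left hij k0)
  have hfin : vecMgf ν t ≠ ⊤ := (hle.trans_lt ENNReal.ofReal_lt_top).ne
  have h1 := hτ t hfin
  have h2 : Real.log (vecMgf ν t).toReal ≤ t ⬝ᵥ τ - c - η := by
    rw [Real.log_le_iff_le_exp (ENNReal.toReal_pos (vecMgf_pos ν t).ne' hfin)]
    exact ENNReal.toReal_le_of_le_ofReal (Real.exp_pos _).le hle
  linarith

/-- Lower bound in Cramér's theorem, without any assumption on exponential moments. -/
theorem eventually_le_pi_empMean_ball (ν : Measure (ι → ℝ)) [IsProbabilityMeasure ν]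
    {c : ℝ} {τ : ι → ℝ} (hτ : τ ∈ cramerSublevel ν c) {ρ η : ℝ} (hρ : 0 < ρ) (hη : 0 < η) :
    ∀ᶠ n : ℕ in atTop, ENNReal.ofReal (1 / 2 * Real.exp (-(n * (c + η)))) ≤
      Measure.pi (fun _ : Fin n => ν) {x | ‖empMean x - τ‖ < ρ} := by
  have hA : 0 < |c| + η / 2 + 1 := by positivity
  set ε := ρ ^ 2 / (16 * (|c| + η / 2 + 1)) with hεdef
  have hε : 0 < ε := by positivity
  obtain ⟨k, t, hk, hfoc, hlow, hup⟩ :=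
    exists_tilt_of_mem_cramerSublevel ν hτ hε (half_pos hη)
  set B : Set (ι → ℝ) := Metric.closedBall 0 (k : ℝ) with hB
  have hM := ae_restrict_closedBall_norm_le ν (k : ℝ)
  rw [← hB] at hM
  have : NeZero (ν.restrict B) := ⟨fun h => hk (Measure.restrict_eq_zero.1 h)⟩
  set z := ∫ x in B, Real.exp (t ⬝ᵥ x) ∂ν with hz
  have hzpos : 0 < z := integral_exp_dotProduct_pos hM t
  have hBm : MeasurableSet B := measurableSet_closedBall
  set g0 : (ι → ℝ) → ℝ≥0 := fun x => Real.toNNReal (Real.exp (t ⬝ᵥ x - Real.log z)) with hg0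
  have hg0m : Measurable g0 :=
    (Real.measurable_exp.comp
      ((continuous_dotProduct_right t).measurable.sub_const _)).real_toNNReal
  set g : (ι → ℝ) → ℝ≥0∞ := B.indicator fun x => (g0 x : ℝ≥0∞) with hg
  have hgm : Measurable g := (hg0m.coe_nnreal_ennreal).indicator hBm
  have hwd : ν.withDensity g = (ν.restrict B).withDensity fun x => (g0 x : ℝ≥0∞) :=
    withDensity_indicator hBm _
  have hexp : ∀ x : ι → ℝ, Real.exp (t ⬝ᵥ x - Real.log z) = Real.exp (t ⬝ᵥ x) / z := fun x => by
    rw [Real.exp_sub, Real.exp_log hzpos]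
  have : IsProbabilityMeasure (ν.withDensity g) := by
    constructor
    rw [hwd, withDensity_apply _ MeasurableSet.univ, Measure.restrict_univ]
    have : ∀ x, (g0 x : ℝ≥0∞) = ENNReal.ofReal (Real.exp (t ⬝ᵥ x) / z) := fun x => by
      rw [← hexp]; rfl
    simp_rw [this]
    rw [← ofReal_integral_eq_lintegral_ofReal ((integrable_exp_dotProduct hM t).div_const z)
      (Eventually.of_forall fun x => by positivity), integral_div, ← hz, div_self hzpos.ne']
    simp
  have hL2 : ∀ i, MemLp (fun x : ι → ℝ => x i) 2 (ν.withDensity g) := fun i => by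
    refine MemLp.of_bound (measurable_pi_apply i).aestronglyMeasurable (k : ℝ) ?_
    rw [hwd]
    filter_upwards [(withDensity_absolutelyContinuous _ _).ae_le hM] with x hx
    exact (norm_le_pi_norm x i).trans hx
  set m : ι → ℝ := fun i => τ i - 2 * ε * t i with hm
  have hmean : ∀ i, m i = ∫ y, y i ∂(ν.withDensity g) := fun i => by
    rw [hwd, integral_withDensity_eq_integral_smul hg0m]
    have : ∀ x : ι → ℝ, g0 x • x i = x i * Real.exp (t ⬝ᵥ x) / z := fun x => by
      rw [NNReal.smul_def, smul_eq_mul, hg0, Real.coe_toNNReal _ (Real.exp_pos _).le, hexp]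
      ring
    simp_rw [this]
    rw [integral_div, hfoc i, mul_div_cancel_right₀ _ hzpos.ne']
  have hgt : ∀ x, g x ≤ ENNReal.ofReal (Real.exp (t ⬝ᵥ x - Real.log z)) := fun x =>
    indicator_le_self _ _ _
  have htt : ε * (t ⬝ᵥ t) ≤ |c| + η / 2 + 1 := by linarith [le_abs_self c]
  have htnorm : ε * ‖t‖ < ρ / 2 := by
    have h1 := mul_le_mul_of_nonneg_left (norm_sq_le_dotProduct_self t) hε.le
    have h2 : ε * ‖t‖ ^ 2 ≤ |c| + η / 2 + 1 := h1.trans htt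
    have h3 : ε * (16 * (|c| + η / 2 + 1)) = ρ ^ 2 := by
      rw [hεdef]; field_simp
    by_contra! h4
    have h5 : (ρ / 2) ^ 2 ≤ (ε * ‖t‖) ^ 2 := pow_le_pow_left₀ (by positivity) h4 2
    have h6 : ε * (ε * ‖t‖ ^ 2) ≤ ε * (|c| + η / 2 + 1) := mul_le_mul_of_nonneg_left h2 hε.le
    nlinarith [sq_pos_of_pos hρ]
  have hmτ : ‖m - τ‖ ≤ 2 * (ε * ‖t‖) := by
    refine (pi_norm_le_iff_of_nonneg (by positivity)).2 fun i => ?_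
    have : (m - τ) i = -(2 * ε * t i) := by simp [hm]
    rw [this, norm_neg, norm_mul, Real.norm_of_nonneg (by positivity : 0 ≤ 2 * ε), mul_assoc]
    gcongr
    exact norm_le_pi_norm t i
  set S := ∑ i, |t i| with hS
  have hS0 : 0 ≤ S := Finset.sum_nonneg fun _ _ => abs_nonneg _
  set r := min (ρ - 2 * (ε * ‖t‖)) (η / (2 * (S + 1))) with hr
  have hr0 : 0 < r := lt_min (by linarith) (by positivity)
  have hSr : S * r ≤ η / 2 := by
    have h1 : r ≤ η / (2 * (S + 1)) := min_le_right _ _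
    have h2 : (S + 1) * r ≤ (S + 1) * (η / (2 * (S + 1))) :=
      mul_le_mul_of_nonneg_left h1 (by positivity)
    have h3 : (S + 1) * (η / (2 * (S + 1))) = η / 2 := by field_simp
    linarith
  have htm : t ⬝ᵥ m = t ⬝ᵥ τ - 2 * (ε * (t ⬝ᵥ t)) := by
    have : m = τ - (2 * ε) • t := by ext i; simp [hm]
    rw [this, dotProduct_sub, dotProduct_smul, smul_eq_mul, mul_assoc]
  have ht0 : 0 ≤ ε * (t ⬝ᵥ t) :=
    mul_nonneg hε.le ((sq_nonneg _).trans (norm_sq_le_dotProduct_self t))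
  filter_upwards [eventually_le_pi_empMean_of_tilt ν hgm hL2 hgt hmean hr0] with n hn
  refine le_trans ?_ (hn.trans (measure_mono fun x hx => ?_))
  · apply ENNReal.ofReal_le_ofReal
    refine mul_le_mul_of_nonneg_left (Real.exp_le_exp.2 (neg_le_neg ?_)) (by norm_num)
    refine mul_le_mul_of_nonneg_left ?_ (Nat.cast_nonneg n)
    linarith
  · have hx' : ‖empMean x - m‖ < r := hx
    have h1 : r ≤ ρ - 2 * (ε * ‖t‖) := min_le_left _ _
    have h2 : ‖empMean x - τ‖ ≤ ‖empMean x - m‖ + ‖m - τ‖ := norm_sub_le_norm_sub_add_norm_sub _ _ _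
    simp only [mem_ofPred_eq]
    linarith

end CramerLowerBound

section GeneralizedNormal

variable {p : ℝ}

lemma integral_exp_neg_mul_abs_rpow (hp : 0 < p) {b : ℝ} (hb : 0 < b) :
    ∫ y : ℝ, Real.exp (-b * |y| ^ p) = 2 * (b ^ (-1 / p) * Real.Gamma (1 / p + 1)) := by
  rw [integral_comp_abs (f := fun y => Real.exp (-b * y ^ p)), integral_exp_neg_mul_rpow hp hb]

lemma integrable_exp_neg_mul_abs_rpow (hp : 0 < p) {b : ℝ} (hb : 0 < b) :
    Integrable fun y : ℝ => Real.exp (-b * |y| ^ p) := by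
  by_contra h
  have h1 := integral_exp_neg_mul_abs_rpow hp hb
  rw [integral_undef h] at h1
  have := Real.Gamma_pos_of_pos (by positivity : 0 < 1 / p + 1)
  have : 0 < 2 * (b ^ (-1 / p) * Real.Gamma (1 / p + 1)) := by positivity
  linarith

/-- The normalizing constant of the generalized normal density. -/
def muPConst (p : ℝ) : ℝ := (2 * p ^ (1/p) * Real.Gamma (1 + 1/p))⁻¹

lemma muPConst_pos (hp : 0 < p) : 0 < muPConst p := by
  have := Real.Gamma_pos_of_pos (by positivity : 0 < 1 + 1 / p)
  unfold muPConst
  positivity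

lemma muP_eq (p : ℝ) : muP p =
    volume.withDensity fun y =>
      ENNReal.ofReal (muPConst p * Real.exp (-(1 / p) * |y| ^ p)) := by
  unfold muP muPConst
  congr 1
  ext y
  congr 4
  ring

lemma measurable_muP_density (p b : ℝ) :
    Measurable fun y : ℝ => Real.exp (b * |y| ^ p) := by
  fun_prop

lemma lintegral_exp_muP_ne_top (hp : 0 < p) {s : ℝ} (hs : s < 1 / p) :
    ∫⁻ y, ENNReal.ofReal (Real.exp (s * |y| ^ p)) ∂(muP p) ≠ ⊤ := by
  rw [muP_eq, lintegral_withDensity_eq_lintegral_mul _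
    ((measurable_muP_density p _).const_mul _).ennreal_ofReal
    (measurable_muP_density p s).ennreal_ofReal]
  have : ∀ y : ℝ, ((fun y => ENNReal.ofReal (muPConst p * Real.exp (-(1 / p) * |y| ^ p))) *
      fun y => ENNReal.ofReal (Real.exp (s * |y| ^ p))) y =
      ENNReal.ofReal (muPConst p * Real.exp (-(1 / p - s) * |y| ^ p)) := fun y => by
    rw [Pi.mul_apply, ← ENNReal.ofReal_mul (mul_nonneg (muPConst_pos hp).le (Real.exp_pos _).le),
      mul_assoc, ← Real.exp_add]
    congr 3
    ring
  simp_rw [this]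
  exact ((integrable_exp_neg_mul_abs_rpow hp (by linarith : 0 < 1 / p - s)).const_mul
    (muPConst p)).lintegral_lt_top.ne

lemma isProbabilityMeasure_muP (hp : 0 < p) : IsProbabilityMeasure (muP p) := by
  constructor
  rw [muP_eq, withDensity_apply _ MeasurableSet.univ, Measure.restrict_univ,
    ← ofReal_integral_eq_lintegral_ofReal
      ((integrable_exp_neg_mul_abs_rpow hp (by positivity)).const_mul _)
      (Eventually.of_forall fun y => mul_nonneg (muPConst_pos hp).le (Real.exp_pos _).le),
    integral_const_mul, integral_exp_neg_mul_abs_rpow hp (by positivity)]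
  have h := Real.Gamma_pos_of_pos (by positivity : 0 < 1 + 1 / p)
  have h2 : (1 / p) ^ (-1 / p) = p ^ (1 / p) := by
    rw [one_div, Real.inv_rpow hp.le, ← Real.rpow_neg hp.le]
    congr 1
    ring
  have h3 : 0 < p ^ (1 / p) := by positivity
  rw [h2, muPConst, add_comm (1 / p) 1]
  rw [show (2 * p ^ (1 / p) * Real.Gamma (1 + 1 / p))⁻¹ *
    (2 * (p ^ (1 / p) * Real.Gamma (1 + 1 / p))) = 1 by field_simp]
  simp

lemma ae_muP_ne_zero (p : ℝ) : ∀ᵐ y ∂(muP p), y ≠ 0 := by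
  unfold muP
  exact (withDensity_absolutelyContinuous _ _).ae_le (Measure.ae_ne volume 0)

lemma map_neg_muP (p : ℝ) : (muP p).map (fun y => -y) = muP p := by
  ext s hs
  have hs' : MeasurableSet ((fun y : ℝ => -y) ⁻¹' s) := measurable_neg hs
  rw [Measure.map_apply measurable_neg hs]
  unfold muP
  rw [withDensity_apply _ hs', withDensity_apply _ hs]
  have := (Measure.measurePreserving_neg (volume : Measure ℝ)).setLIntegral_comp_preimage_emb
    (MeasurableEquiv.neg ℝ).measurableEmbedding (fun y => ENNReal.ofReal
      ((2 * p ^ (1/p) * Real.Gamma (1 + 1/p))⁻¹ * Real.exp (-(|y| ^ p) / p))) s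
  rw [← this]
  simp only [abs_neg]

end GeneralizedNormal

section CramerSublevelPositive

variable {ι : Type*} [Fintype ι]

lemma pos_of_mem_cramerSublevel [DecidableEq ι] (ν : Measure (ι → ℝ)) [IsProbabilityMeasure ν]
    {i : ι} (hpos : ∀ᵐ x ∂ν, 0 < x i) {c : ℝ} {τ : ι → ℝ} (hτ : τ ∈ cramerSublevel ν c) :
    0 < τ i := by
  by_contra! hcon
  have hdot : ∀ (k : ℕ) (x : ι → ℝ), Pi.single i (-(k : ℝ)) ⬝ᵥ x = -(k * x i) := fun k x => by
    rw [single_dotProduct, neg_mul]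
  have hlim : Tendsto (fun k : ℕ => vecMgf ν (Pi.single i (-(k : ℝ)))) atTop
      (𝓝 (∫⁻ _, 0 ∂ν)) := by
    refine tendsto_lintegral_of_dominated_convergence' (fun _ => 1)
      (fun k => (measurable_ofReal_exp_dotProduct _).aemeasurable) (fun k => ?_) (by simp) ?_
    · filter_upwards [hpos] with x hx
      rw [hdot, ← ENNReal.ofReal_one]
      refine ENNReal.ofReal_le_ofReal (Real.exp_le_one_iff.2 ?_)
      have : 0 ≤ (k : ℝ) * x i := by positivity
      linarith
    · filter_upwards [hpos] with x hx
      simp_rw [hdot]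
      rw [← ENNReal.ofReal_zero]
      refine ENNReal.tendsto_ofReal (Real.tendsto_exp_neg_atTop_nhds_zero.comp ?_)
      exact tendsto_natCast_atTop_atTop.atTop_mul_const hx
  rw [lintegral_zero] at hlim
  have hpos' : (0 : ℝ≥0∞) < ENNReal.ofReal (Real.exp (-c)) := by simp [Real.exp_pos]
  obtain ⟨k, hk⟩ := (hlim.eventually_lt_const hpos').exists
  have hfin : vecMgf ν (Pi.single i (-(k : ℝ))) ≠ ⊤ := (hk.trans ENNReal.ofReal_lt_top).ne
  have h1 := hτ _ hfin
  rw [hdot] at h1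
  have h2 : (k : ℝ) * τ i ≤ 0 := mul_nonpos_of_nonneg_of_nonpos (Nat.cast_nonneg k) hcon
  have h3 : (vecMgf ν (Pi.single i (-(k : ℝ)))).toReal < Real.exp (-c) := by
    rw [← ENNReal.toReal_ofReal (Real.exp_pos (-c)).le]
    exact (ENNReal.toReal_lt_toReal hfin ENNReal.ofReal_ne_top).2 hk
  have h4 := (Real.log_lt_iff_lt_exp (ENNReal.toReal_pos (vecMgf_pos ν _).ne' hfin)).2 h3
  linarith

end CramerSublevelPositive

section ProjectionLaw

variable {p : ℝ}

/-- The triple of statistics `(z², zy, |y|^p)`. -/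
def projStat (p : ℝ) (q : ℝ × ℝ) : Fin 3 → ℝ := ![q.2 ^ 2, q.2 * q.1, |q.1| ^ p]

/-- The law of `(Z², ZY, |Y|^p)` for independent `Y ∼ μ_p` and `Z ∼ μ₂`. -/
def projLaw (p : ℝ) : Measure (Fin 3 → ℝ) := ((muP p).prod (muP 2)).map (projStat p)

lemma measurable_projStat (p : ℝ) : Measurable (projStat p) := by
  unfold projStat
  rw [measurable_pi_iff]
  intro i
  fin_cases i <;> simp <;> fun_prop

lemma dotProduct_projStat (p : ℝ) (t : Fin 3 → ℝ) (q : ℝ × ℝ) :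
    t ⬝ᵥ projStat p q = t 0 * q.2 ^ 2 + t 1 * q.2 * q.1 + t 2 * |q.1| ^ p := by
  simp [projStat, dotProduct, Fin.sum_univ_three]
  ring

lemma isProbabilityMeasure_projLaw (hp : 0 < p) : IsProbabilityMeasure (projLaw p) := by
  have := isProbabilityMeasure_muP hp
  have := isProbabilityMeasure_muP (two_pos (α := ℝ))
  exact Measure.isProbabilityMeasure_map (measurable_projStat p).aemeasurable

lemma vecMgf_projLaw (hp : 0 < p) (t : Fin 3 → ℝ) : vecMgf (projLaw p) t =
    ∫⁻ y, (∫⁻ z, ENNReal.ofReal (Real.exp (t 0 * z ^ 2 + t 1 * z * y + t 2 * |y| ^ p))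
      ∂(muP 2)) ∂(muP p) := by
  have := isProbabilityMeasure_muP hp
  have := isProbabilityMeasure_muP (two_pos (α := ℝ))
  unfold vecMgf projLaw
  rw [lintegral_map (measurable_ofReal_exp_dotProduct t) (measurable_projStat p), lintegral_prod
    (fun q => ENNReal.ofReal (Real.exp (t ⬝ᵥ projStat p q)))
    ((measurable_ofReal_exp_dotProduct t).comp (measurable_projStat p)).aemeasurable]
  simp_rw [dotProduct_projStat]

lemma Phi_eq_log_vecMgf (hp : 0 < p) (t : ℝ × ℝ × ℝ) :
    Phi p t = ENNReal.log (vecMgf (projLaw p) ![t.1, t.2.1, t.2.2]) := by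
  rw [vecMgf_projLaw hp]
  rfl

lemma legendre3_Phi_le_iff (hp : 0 < p) (x : Fin 3 → ℝ) (c : ℝ) :
    legendre3 (Phi p) (x 0, x 1, x 2) ≤ c ↔ x ∈ cramerSublevel (projLaw p) c := by
  have := isProbabilityMeasure_projLaw hp
  have key : ∀ t : Fin 3 → ℝ, ((t ⬝ᵥ x : ℝ) : EReal) - ENNReal.log (vecMgf (projLaw p) t) ≤ c ↔
      (vecMgf (projLaw p) t ≠ ⊤ → t ⬝ᵥ x ≤ c + Real.log (vecMgf (projLaw p) t).toReal) := by
    intro t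
    by_cases ht : vecMgf (projLaw p) t = ⊤
    · simp [ht]
    · rw [ENNReal.log_pos_real (vecMgf_pos _ t).ne' ht, ← EReal.coe_sub, EReal.coe_le_coe_iff,
        sub_le_iff_le_add]
      simp [ht]
  unfold legendre3 cramerSublevel
  rw [iSup_le_iff, mem_ofPred_eq]
  constructor
  · intro h t
    rw [← key]
    have h1 := h (t 0, t 1, t 2)
    rw [Phi_eq_log_vecMgf hp] at h1
    have h2 : ![t 0, t 1, t 2] = t := by ext i; fin_cases i <;> rfl
    simp only [h2] at h1
    convert h1 using 3
    simp [dotProduct, Fin.sum_univ_three]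
  · intro h t
    rw [Phi_eq_log_vecMgf hp]
    convert (key _).2 (h ![t.1, t.2.1, t.2.2]) using 3
    simp [dotProduct, Fin.sum_univ_three]

lemma hasExpMoments_projLaw (hp : 2 ≤ p) : HasExpMoments (projLaw p) := by
  have hp0 : 0 < p := by linarith
  have := isProbabilityMeasure_muP hp0
  have := isProbabilityMeasure_muP (two_pos (α := ℝ))
  have hsq : ∀ y : ℝ, y ^ 2 ≤ 1 + |y| ^ p := fun y => by
    rw [← sq_abs]
    rcases le_total |y| 1 with h | h
    · have h1 : |y| ^ 2 ≤ 1 := pow_le_one₀ (abs_nonneg y) h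
      have h2 : 0 ≤ |y| ^ p := by positivity
      linarith
    · have h1 := Real.rpow_le_rpow_of_exponent_le h hp
      rw [Real.rpow_two] at h1
      linarith
  set δ : ℝ := 1 / (2 * p) with hδ
  have hδ0 : 0 < δ := by positivity
  have hfin : ∀ t : Fin 3 → ℝ, (∀ q, t ⬝ᵥ projStat p q ≤ δ * (1 + q.2 ^ 2 + |q.1| ^ p)) →
      vecMgf (projLaw p) t ≠ ⊤ := by
    intro t ht
    unfold vecMgf projLaw
    rw [lintegral_map (measurable_ofReal_exp_dotProduct t) (measurable_projStat p)]
    have hb : ∫⁻ q, ENNReal.ofReal (Real.exp (t ⬝ᵥ projStat p q)) ∂((muP p).prod (muP 2)) ≤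
        ∫⁻ q, ENNReal.ofReal (Real.exp (δ + δ * |q.1| ^ p)) *
          ENNReal.ofReal (Real.exp (δ * |q.2| ^ (2 : ℝ))) ∂((muP p).prod (muP 2)) := by
      refine lintegral_mono fun q => ?_
      rw [← ENNReal.ofReal_mul (Real.exp_pos _).le, ← Real.exp_add]
      refine ENNReal.ofReal_le_ofReal (Real.exp_le_exp.2 ((ht q).trans (le_of_eq ?_)))
      rw [Real.rpow_two, sq_abs]
      ring
    refine (hb.trans_lt ?_).ne
    rw [lintegral_prod_mul (f := fun y : ℝ => ENNReal.ofReal (Real.exp (δ + δ * |y| ^ p)))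
      (g := fun z : ℝ => ENNReal.ofReal (Real.exp (δ * |z| ^ (2 : ℝ)))) (by fun_prop) (by fun_prop)]
    refine ENNReal.mul_lt_top ?_ ?_
    · simp_rw [Real.exp_add, ENNReal.ofReal_mul (Real.exp_pos _).le]
      rw [lintegral_const_mul _ (measurable_muP_density p δ).ennreal_ofReal]
      refine ENNReal.mul_lt_top ENNReal.ofReal_lt_top (lintegral_exp_muP_ne_top hp0 ?_).lt_top
      rw [hδ]
      exact one_div_lt_one_div_of_lt hp0 (by linarith)
    · refine (lintegral_exp_muP_ne_top two_pos ?_).lt_top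
      rw [hδ]
      exact one_div_lt_one_div_of_lt two_pos (by linarith)
  refine ⟨δ, hδ0, fun i => ⟨hfin _ fun q => ?_, hfin _ fun q => ?_⟩⟩
  all_goals
    rw [single_dotProduct, ← sub_nonneg]
    have h0 : 0 ≤ |q.1| ^ p := by positivity
    have h1 := hsq q.1
    have h2 := mul_nonneg hδ0.le h0
    have h3 := mul_nonneg hδ0.le (sq_nonneg q.2)
    have h4 := mul_nonneg hδ0.le (sub_nonneg.2 h1)
    have h5 := mul_nonneg hδ0.le (sq_nonneg (q.2 - q.1))
    have h6 := mul_nonneg hδ0.le (sq_nonneg (q.2 + q.1))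
    fin_cases i <;> simp [projStat] <;> nlinarith

lemma ae_projLaw_pos (hp : 0 < p) : ∀ᵐ x ∂(projLaw p), 0 < x 0 ∧ 0 < x 2 := by
  have := isProbabilityMeasure_muP hp
  have := isProbabilityMeasure_muP (two_pos (α := ℝ))
  unfold projLaw
  have hs : MeasurableSet {x : Fin 3 → ℝ | 0 < x 0 ∧ 0 < x 2} :=
    (measurableSet_lt measurable_const (measurable_pi_apply 0)).inter
      (measurableSet_lt measurable_const (measurable_pi_apply 2))
  rw [ae_map_iff (measurable_projStat p).aemeasurable hs]
  have h1 : ∀ᵐ q ∂((muP p).prod (muP 2)), q.1 ≠ 0 :=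
    Measure.quasiMeasurePreserving_fst.ae (ae_muP_ne_zero p)
  have h2 : ∀ᵐ q ∂((muP p).prod (muP 2)), q.2 ≠ 0 :=
    Measure.quasiMeasurePreserving_snd.ae (ae_muP_ne_zero 2)
  filter_upwards [h1, h2] with q hq1 hq2
  exact ⟨by simp [projStat]; positivity, by simp [projStat]; positivity⟩

lemma pos_of_mem_cramerSublevel_projLaw (hp : 0 < p) {c : ℝ} {x : Fin 3 → ℝ}
    (hx : x ∈ cramerSublevel (projLaw p) c) : 0 < x 0 ∧ 0 < x 2 := by
  have := isProbabilityMeasure_projLaw hp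
  exact ⟨pos_of_mem_cramerSublevel _ ((ae_projLaw_pos hp).mono fun _ h => h.1) hx,
    pos_of_mem_cramerSublevel _ ((ae_projLaw_pos hp).mono fun _ h => h.2) hx⟩

end ProjectionLaw

section AnnealedRate

variable {p : ℝ}

/-- The self-normalized quotient `x₀^{-1/2} x₁ x₂^{-1/p}`. -/
def projQuot (p : ℝ) (x : Fin 3 → ℝ) : ℝ := x 0 ^ (-(1:ℝ)/2) * x 1 * x 2 ^ (-(1:ℝ)/p)

lemma projQuot_eq_iff {x : Fin 3 → ℝ} (h0 : 0 < x 0) (h2 : 0 < x 2) (w : ℝ) :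
    projQuot p x = w ↔ x 1 = w * (x 0 ^ ((1:ℝ)/2) * x 2 ^ ((1:ℝ)/p)) := by
  have e0 : x 0 ^ (-(1:ℝ)/2) = (x 0 ^ ((1:ℝ)/2))⁻¹ := by
    rw [← Real.rpow_neg h0.le]; congr 1; ring
  have e2 : x 2 ^ (-(1:ℝ)/p) = (x 2 ^ ((1:ℝ)/p))⁻¹ := by
    rw [← Real.rpow_neg h2.le]; congr 1; ring
  have p0 : 0 < x 0 ^ ((1:ℝ)/2) := Real.rpow_pos_of_pos h0 _
  have p2 : 0 < x 2 ^ ((1:ℝ)/p) := Real.rpow_pos_of_pos h2 _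
  rw [projQuot, e0, e2]
  constructor
  · rintro rfl
    field_simp
  · intro h
    rw [h]
    field_simp

lemma continuousAt_projQuot {x : Fin 3 → ℝ} (h0 : 0 < x 0) (h2 : 0 < x 2) :
    ContinuousAt (projQuot p) x := by
  unfold projQuot
  have c0 : ContinuousAt (fun x : Fin 3 → ℝ => x 0) x := (continuous_apply 0).continuousAt
  have c1 : ContinuousAt (fun x : Fin 3 → ℝ => x 1) x := (continuous_apply 1).continuousAt
  have c2 : ContinuousAt (fun x : Fin 3 → ℝ => x 2) x := (continuous_apply 2).continuousAt
  exact ((c0.rpow_const (Or.inl h0.ne')).mul c1).mul (c2.rpow_const (Or.inl h2.ne'))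

lemma cramerSublevel_mono {ι : Type*} [Fintype ι] (ν : Measure (ι → ℝ)) {c d : ℝ} (h : c ≤ d) :
    cramerSublevel ν c ⊆ cramerSublevel ν d :=
  fun _ hx t ht => (hx t ht).trans (by linarith)

lemma Ia_le_of_mem (hp : 0 < p) {c : ℝ} {x : Fin 3 → ℝ} (hx : x ∈ cramerSublevel (projLaw p) c) :
    Ia p (projQuot p x) ≤ c := by
  obtain ⟨h0, h2⟩ := pos_of_mem_cramerSublevel_projLaw hp hx
  unfold Ia
  exact (iInf₂_le (x 0, x 1, x 2) ⟨h0, h2, rfl⟩).trans ((legendre3_Phi_le_iff hp x c).2 hx)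

lemma exists_mem_of_Ia_lt (hp : 0 < p) {c w : ℝ} (h : Ia p w < c) :
    ∃ x ∈ cramerSublevel (projLaw p) c, projQuot p x = w := by
  unfold Ia at h
  obtain ⟨τ, hτ, hlt⟩ := by simpa only [iInf_lt_iff] using h
  refine ⟨![τ.1, τ.2.1, τ.2.2], (legendre3_Phi_le_iff hp _ c).1 hlt.le, ?_⟩
  exact hτ.2.2

lemma sublevel_Ia (hp : 2 ≤ p) (c : ℝ) :
    {w | Ia p w ≤ c} = projQuot p '' cramerSublevel (projLaw p) c := by
  have hp0 : 0 < p := by linarith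
  refine Subset.antisymm (fun w hw => ?_) ?_
  · set K : ℕ → Set (Fin 3 → ℝ) := fun k => cramerSublevel (projLaw p) (c + 1 / ((k : ℝ) + 1)) ∩
      {x | x 1 = w * (x 0 ^ ((1:ℝ)/2) * x 2 ^ ((1:ℝ)/p))} with hK
    have hcl : IsClosed {x : Fin 3 → ℝ | x 1 = w * (x 0 ^ ((1:ℝ)/2) * x 2 ^ ((1:ℝ)/p))} := by
      refine isClosed_eq (continuous_apply 1) (continuous_const.mul ?_)
      exact ((continuous_apply 0).rpow_const fun _ => Or.inr (by norm_num)).mul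
        ((continuous_apply 2).rpow_const fun _ => Or.inr (by positivity))
    obtain ⟨x, hx⟩ : (⋂ k, K k).Nonempty := by
      refine IsCompact.nonempty_iInter_of_sequence_nonempty_isCompact_isClosed K ?_ ?_ ?_ ?_
      · intro k
        refine inter_subset_inter_left _ (cramerSublevel_mono _ ?_)
        push_cast
        gcongr
        linarith
      · intro k
        have hlt : Ia p w < ((c + 1 / ((k : ℝ) + 1) : ℝ) : EReal) := by
          refine lt_of_le_of_lt hw (EReal.coe_lt_coe_iff.2 ?_)
          have : 0 < 1 / ((k : ℝ) + 1) := by positivity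
          linarith
        obtain ⟨x, hx, hxw⟩ := exists_mem_of_Ia_lt hp0 hlt
        obtain ⟨h0, h2⟩ := pos_of_mem_cramerSublevel_projLaw hp0 hx
        exact ⟨x, hx, (projQuot_eq_iff h0 h2 w).1 hxw⟩
      · exact (isCompact_cramerSublevel (hasExpMoments_projLaw hp) _).inter_right hcl
      · exact fun k => (isClosed_cramerSublevel _ _).inter hcl
    have hxc : x ∈ cramerSublevel (projLaw p) c := by
      intro t ht
      have h1 : ∀ k : ℕ, t ⬝ᵥ x ≤
          c + 1 / ((k : ℝ) + 1) + Real.log (vecMgf (projLaw p) t).toReal :=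
        fun k => (mem_iInter.1 hx k).1 t ht
      have h2 : Tendsto (fun k : ℕ => c + 1 / ((k : ℝ) + 1) +
          Real.log (vecMgf (projLaw p) t).toReal) atTop
          (𝓝 (c + 0 + Real.log (vecMgf (projLaw p) t).toReal)) :=
        (tendsto_one_div_add_atTop_nhds_zero_nat.const_add c).add_const _
      rw [add_zero] at h2
      exact ge_of_tendsto' h2 h1
    obtain ⟨h0, h2⟩ := pos_of_mem_cramerSublevel_projLaw hp0 hxc
    exact ⟨x, hxc, (projQuot_eq_iff h0 h2 w).2 (mem_iInter.1 hx 0).2⟩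
  · rintro _ ⟨x, hx, rfl⟩
    exact Ia_le_of_mem hp0 hx

lemma continuousOn_projQuot (hp : 0 < p) (c : ℝ) :
    ContinuousOn (projQuot p) (cramerSublevel (projLaw p) c) := fun x hx => by
  obtain ⟨h0, h2⟩ := pos_of_mem_cramerSublevel_projLaw hp hx
  exact (continuousAt_projQuot h0 h2).continuousWithinAt

lemma hasCompactSublevels_Ia (hp : 2 ≤ p) : HasCompactSublevels (Ia p) := fun c => by
  rw [sublevel_Ia hp]
  exact (isCompact_cramerSublevel (hasExpMoments_projLaw hp) c).image_of_continuousOn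
    (continuousOn_projQuot (by linarith) c)

lemma Ia_nonneg (hp : 0 < p) (w : ℝ) : 0 ≤ Ia p w := by
  by_contra! h
  have := isProbabilityMeasure_projLaw hp
  obtain ⟨c, h1, h2⟩ := EReal.lt_iff_exists_real_btwn.1 h
  obtain ⟨x, hx, _⟩ := exists_mem_of_Ia_lt hp h1
  have hv : vecMgf (projLaw p) 0 = 1 := by simp [vecMgf]
  have h3 := hx 0 (by rw [hv]; simp)
  rw [hv] at h3
  simp only [zero_dotProduct, ENNReal.toReal_one, Real.log_one, add_zero] at h3
  have h4 : c < 0 := by exact_mod_cast h2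
  linarith

lemma quasiconvexRate_Ia (hp : 2 ≤ p) : QuasiconvexRate (Ia p) := fun c => by
  induction c with
  | bot =>
    have : {x | Ia p x ≤ ⊥} = ∅ := by
      ext x
      simp only [mem_ofPred_eq, mem_empty_iff_false, iff_false, not_le]
      exact lt_of_lt_of_le EReal.bot_lt_zero (Ia_nonneg (by linarith) x)
    rw [this]
    exact convex_empty
  | top =>
    simp only [le_top]
    exact convex_univ
  | coe c =>
    rw [sublevel_Ia hp]
    exact ((convex_cramerSublevel (projLaw p) c).isPreconnected.image _
      (continuousOn_projQuot (by linarith) c)).ordConnected.convex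

lemma lowerSemicontinuous_Ia (hp : 2 ≤ p) : LowerSemicontinuous (Ia p) := by
  rw [lowerSemicontinuous_iff_isClosed_preimage]
  intro c
  induction c with
  | bot =>
    have : Ia p ⁻¹' Iic ⊥ = ∅ := by
      ext x
      simp only [mem_preimage, mem_Iic, mem_empty_iff_false, iff_false, not_le]
      exact lt_of_lt_of_le EReal.bot_lt_zero (Ia_nonneg (by linarith) x)
    rw [this]
    exact isClosed_empty
  | top => simp
  | coe c => exact (hasCompactSublevels_Ia hp c).isClosed

/-- Reflection of the middle coordinate. -/
def flipMid (x : Fin 3 → ℝ) : Fin 3 → ℝ := ![x 0, -x 1, x 2]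

lemma dotProduct_flipMid (t x : Fin 3 → ℝ) : t ⬝ᵥ flipMid x = flipMid t ⬝ᵥ x := by
  simp [flipMid, dotProduct, Fin.sum_univ_three]

lemma vecMgf_flipMid (hp : 0 < p) (t : Fin 3 → ℝ) :
    vecMgf (projLaw p) (flipMid t) = vecMgf (projLaw p) t := by
  rw [vecMgf_projLaw hp, vecMgf_projLaw hp]
  refine lintegral_congr fun y => ?_
  conv_rhs => rw [← map_neg_muP 2]
  rw [lintegral_map (by fun_prop) measurable_neg]
  simp [flipMid]

lemma flipMid_mem (hp : 0 < p) {c : ℝ} {x : Fin 3 → ℝ} (hx : x ∈ cramerSublevel (projLaw p) c) :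
    flipMid x ∈ cramerSublevel (projLaw p) c := by
  intro t ht
  rw [dotProduct_flipMid, ← vecMgf_flipMid hp]
  exact hx _ (by rwa [vecMgf_flipMid hp])

lemma projQuot_flipMid (x : Fin 3 → ℝ) : projQuot p (flipMid x) = -projQuot p x := by
  simp [projQuot, flipMid]

lemma symmetricRate_Ia (hp : 0 < p) : SymmetricRate (Ia p) := by
  have key : ∀ w, Ia p (-w) ≤ Ia p w := fun w => by
    by_contra! h
    obtain ⟨c, h1, h2⟩ := EReal.lt_iff_exists_real_btwn.1 h
    obtain ⟨x, hx, rfl⟩ := exists_mem_of_Ia_lt hp h1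
    have := Ia_le_of_mem hp (flipMid_mem hp hx)
    rw [projQuot_flipMid] at this
    exact absurd this (not_le.2 h2)
  intro w
  refine le_antisymm (key w) ?_
  simpa using key (-w)

lemma Ia_mono_abs (hp : 2 ≤ p) {a b : ℝ} (h : |a| ≤ |b|) : Ia p a ≤ Ia p b := by
  have hb : b ∈ {w | Ia p w ≤ Ia p b} := le_refl (Ia p b)
  have hb' : -b ∈ {w | Ia p w ≤ Ia p b} := (symmetricRate_Ia (by linarith) b).le
  have hord := (quasiconvexRate_Ia hp (Ia p b)).ordConnected
  rcases abs_cases b with ⟨e, -⟩ | ⟨e, -⟩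
  · rw [e, abs_le] at h
    exact hord.out hb' hb ⟨h.1, h.2⟩
  · rw [e, abs_le, neg_neg] at h
    exact hord.out hb hb' ⟨h.1, h.2⟩

/-- The set of triples whose quotient is at least `a` in absolute value. -/
def quotTail (p a : ℝ) : Set (Fin 3 → ℝ) :=
  {x | 0 ≤ x 0 ∧ 0 ≤ x 2 ∧ a * (x 0 ^ ((1:ℝ)/2) * x 2 ^ ((1:ℝ)/p)) ≤ |x 1|}

lemma isClosed_quotTail (hp : 0 < p) (a : ℝ) : IsClosed (quotTail p a) := by
  refine (isClosed_le continuous_const (continuous_apply 0)).inter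
    ((isClosed_le continuous_const (continuous_apply 2)).inter
      (isClosed_le (continuous_const.mul ?_) (continuous_apply 1).abs))
  exact ((continuous_apply 0).rpow_const fun _ => Or.inr (by norm_num)).mul
    ((continuous_apply 2).rpow_const fun _ => Or.inr (by positivity))

lemma disjoint_quotTail (hp : 2 ≤ p) {a c : ℝ} (ha : 0 ≤ a) (h : (c : EReal) < Ia p a) :
    Disjoint (quotTail p a) (cramerSublevel (projLaw p) c) := by
  have hp0 : 0 < p := by linarith
  rw [Set.disjoint_left]
  intro x hx hxc
  obtain ⟨h0, h2⟩ := pos_of_mem_cramerSublevel_projLaw hp0 hxc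
  have h1 := (projQuot_eq_iff (p := p) h0 h2 _).1 rfl
  have hpos : 0 < x 0 ^ ((1:ℝ)/2) * x 2 ^ ((1:ℝ)/p) :=
    mul_pos (Real.rpow_pos_of_pos h0 _) (Real.rpow_pos_of_pos h2 _)
  have h3 := hx.2.2
  rw [h1, abs_mul, abs_of_pos hpos] at h3
  have h4 : a ≤ |projQuot p x| := le_of_mul_le_mul_right h3 hpos
  have h5 := (Ia_mono_abs hp (by rwa [abs_of_nonneg ha])).trans (Ia_le_of_mem hp0 hxc)
  exact absurd h5 (not_le.2 h)

/-- The annealed rate function vanishes at the origin. -/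
lemma Ia_zero (hp : 2 ≤ p) : Ia p 0 = 0 := by
  have hp0 : 0 < p := by linarith
  refine le_antisymm ?_ (Ia_nonneg hp0 0)
  by_contra! h
  have := isProbabilityMeasure_projLaw hp0
  obtain ⟨c, h1, h2⟩ := EReal.lt_iff_exists_real_btwn.1 h
  have hc : 0 < c := by exact_mod_cast h1
  have hempty : cramerSublevel (projLaw p) c = ∅ := by
    refine eq_empty_of_forall_notMem fun x hx => ?_
    have := (Ia_mono_abs hp (by simp : |(0 : ℝ)| ≤ |projQuot p x|)).trans (Ia_le_of_mem hp0 hx)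
    exact absurd this (not_le.2 h2)
  obtain ⟨K, hK⟩ := pi_empMean_mem_closed_le (hasExpMoments_projLaw hp) isClosed_univ
    (c := c) (by rw [hempty]; exact disjoint_empty _)
  simp only [mem_univ, ofPred_true, measure_univ] at hK
  have hlim : Tendsto (fun n : ℕ => (K : ℝ≥0∞) * ENNReal.ofReal (Real.exp (-(n * c)))) atTop
      (𝓝 (K * ENNReal.ofReal 0)) := by
    refine ENNReal.Tendsto.const_mul (ENNReal.tendsto_ofReal ?_) (Or.inr (by simp))
    exact Real.tendsto_exp_neg_atTop_nhds_zero.comp (tendsto_natCast_atTop_atTop.atTop_mul_const hc)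
  have := ge_of_tendsto' hlim hK
  simp at this

end AnnealedRate

section LpBall

open scoped Pointwise

variable {p : ℝ} {n : ℕ}

/-- The `p`-th power of the `ℓ^p` norm. -/
def lpSum (p : ℝ) (x : Fin n → ℝ) : ℝ := ∑ i, |x i| ^ p

lemma lpSum_nonneg (x : Fin n → ℝ) : 0 ≤ lpSum p x :=
  Finset.sum_nonneg fun _ _ => Real.rpow_nonneg (abs_nonneg _) _

lemma measurable_lpSum : Measurable (lpSum p : (Fin n → ℝ) → ℝ) := by
  unfold lpSum; fun_prop

lemma lpSum_smul {c : ℝ} (hc : 0 ≤ c) (x : Fin n → ℝ) : lpSum p (c • x) = c ^ p * lpSum p x := by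
  simp only [lpSum, Pi.smul_apply, smul_eq_mul, abs_mul, abs_of_nonneg hc, Finset.mul_sum]
  exact Finset.sum_congr rfl fun i _ => Real.mul_rpow hc (abs_nonneg _)

lemma pi_muP_eq (hp : 0 < p) : Measure.pi (fun _ : Fin n => muP p) =
    (volume : Measure (Fin n → ℝ)).withDensity fun x =>
      ENNReal.ofReal (muPConst p ^ n) * ENNReal.ofReal (Real.exp (-(1 / p) * lpSum p x)) := by
  have hprob := isProbabilityMeasure_muP hp
  rw [muP_eq] at hprob ⊢
  rw [pi_withDensity_const volume ((measurable_muP_density p _).const_mul _).ennreal_ofReal,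
    ← volume_pi]
  congr 1
  ext x
  rw [← ENNReal.ofReal_prod_of_nonneg
    fun i _ => mul_nonneg (muPConst_pos hp).le (Real.exp_pos _).le,
    ← ENNReal.ofReal_mul (pow_nonneg (muPConst_pos hp).le n), Finset.prod_mul_distrib,
    ← Real.exp_sum, ← Finset.mul_sum]
  simp [lpSum]

lemma volume_inter_lpSum_le (hp : 0 < p) {E : Set (Fin n → ℝ)}
    (hE : ∀ c : ℝ, 0 < c → ∀ x, c • x ∈ E ↔ x ∈ E) {s : ℝ} (hs : 0 < s) :
    volume (E ∩ {x | lpSum p x ≤ s}) =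
      ENNReal.ofReal ((s ^ (1 / p)) ^ n) * volume (E ∩ lpBall n p) := by
  have hc : 0 < s ^ (1 / p) := Real.rpow_pos_of_pos hs _
  have hcp : (s ^ (1 / p)) ^ p = s := by
    rw [← Real.rpow_mul hs.le, one_div_mul_cancel hp.ne', Real.rpow_one]
  have h : E ∩ {x | lpSum p x ≤ s} = (s ^ (1 / p)) • (E ∩ lpBall n p) := by
    ext x
    rw [mem_smul_set_iff_inv_smul_mem₀ hc.ne']
    refine and_congr (hE _ (inv_pos.2 hc) x).symm ?_
    change lpSum p x ≤ s ↔ lpSum p _ ≤ 1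
    rw [lpSum_smul (inv_pos.2 hc).le, Real.inv_rpow hc.le, hcp, inv_mul_le_one₀ hs]
  rw [h, Measure.addHaar_smul]
  simp only [Module.finrank_fintype_fun_eq_card, Fintype.card_fin]
  rw [abs_of_pos (pow_pos hc n)]

lemma measurableSet_lpBall : MeasurableSet (lpBall n p) :=
  measurableSet_le (measurable_lpSum (p := p)) measurable_const

lemma exists_pi_muP_eq_mul_volume (hp : 0 < p) : ∃ C : ℝ≥0∞,
    ∀ E : Set (Fin n → ℝ), MeasurableSet E → (∀ c : ℝ, 0 < c → ∀ x, c • x ∈ E ↔ x ∈ E) →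
      Measure.pi (fun _ : Fin n => muP p) E = C * volume (E ∩ lpBall n p) := by
  refine ⟨ENNReal.ofReal (muPConst p ^ n) * ∫⁻ t in Ioi (0 : ℝ),
    ENNReal.ofReal (if t < 1 then ((-p * Real.log t) ^ (1 / p)) ^ n else 0), fun E hE hinv => ?_⟩
  have hm : Measurable fun x : Fin n → ℝ => Real.exp (-(1 / p) * lpSum p x) :=
    Real.measurable_exp.comp (measurable_lpSum.const_mul _)
  rw [pi_muP_eq hp, withDensity_apply _ hE, lintegral_const_mul _ hm.ennreal_ofReal,
    lintegral_eq_lintegral_meas_le _ (Eventually.of_forall fun x => (Real.exp_pos _).le)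
      hm.aemeasurable, mul_assoc]
  congr 1
  rw [← lintegral_mul_const'']
  · refine lintegral_congr_ae ?_
    filter_upwards [ae_restrict_mem measurableSet_Ioi,
      ae_restrict_of_ae (Measure.ae_ne volume (1 : ℝ))] with t ht ht1
    have ht0 : 0 < t := ht
    rw [Measure.restrict_apply' hE]
    have hset : {x : Fin n → ℝ | t ≤ Real.exp (-(1 / p) * lpSum p x)} =
        {x | lpSum p x ≤ -p * Real.log t} := by
      ext x
      simp only [mem_ofPred_eq]
      rw [← Real.log_le_iff_le_exp ht0, neg_mul, le_neg, one_div, inv_mul_le_iff₀ hp, neg_mul,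
        mul_neg]
    rw [hset, inter_comm]
    rcases lt_or_gt_of_ne ht1 with h | h
    · rw [if_pos h]
      refine volume_inter_lpSum_le hp hinv ?_
      have := Real.log_neg ht0 h
      nlinarith
    · rw [if_neg (not_lt.2 h.le)]
      have : {x : Fin n → ℝ | lpSum p x ≤ -p * Real.log t} = ∅ := by
        refine eq_empty_of_forall_notMem fun x hx => ?_
        have h1 := Real.log_pos h
        have h2 : lpSum p x ≤ -p * Real.log t := hx
        have h3 := lpSum_nonneg (p := p) x
        nlinarith
      rw [this, inter_empty, measure_empty, ENNReal.ofReal_zero, zero_mul]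
  · refine Measurable.aemeasurable ?_
    refine (Measurable.ite measurableSet_Iio ?_ measurable_const).ennreal_ofReal
    fun_prop

lemma volume_lpBall_ne (hp : 0 < p) :
    volume (lpBall n p) ≠ 0 ∧ volume (lpBall n p) ≠ ⊤ := by
  have := isProbabilityMeasure_muP hp
  obtain ⟨C, hC⟩ := exists_pi_muP_eq_mul_volume (n := n) hp
  have h := hC univ MeasurableSet.univ (by simp)
  rw [measure_univ, univ_inter] at h
  refine ⟨fun h0 => ?_, fun h0 => ?_⟩
  · simp [h0] at h
  · rw [h0] at h
    have hC0 : C ≠ 0 := fun h' => by simp [h'] at h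
    rw [ENNReal.mul_top hC0] at h
    exact ENNReal.one_ne_top h

/-- The uniform law on the `ℓ^p` ball and the `p`-generalized normal product measure agree on
scale invariant sets. -/
lemma uniformLpBall_eq_pi_muP (hp : 0 < p) {E : Set (Fin n → ℝ)}
    (hE : MeasurableSet E) (hinv : ∀ c : ℝ, 0 < c → ∀ x, c • x ∈ E ↔ x ∈ E) :
    uniformLpBall n p E = Measure.pi (fun _ : Fin n => muP p) E := by
  have := isProbabilityMeasure_muP hp
  obtain ⟨C, hC⟩ := exists_pi_muP_eq_mul_volume (n := n) hp
  have h := hC univ MeasurableSet.univ (by simp)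
  rw [measure_univ, univ_inter] at h
  rw [hC E hE hinv, uniformLpBall, Measure.smul_apply, Measure.restrict_apply hE, smul_eq_mul,
    ENNReal.eq_inv_of_mul_eq_one_left h.symm]

lemma le_uniformLpBall_inter (hp : 0 < p) (hn : 0 < n) {E : Set (Fin n → ℝ)}
    (hE : MeasurableSet E) (hinv : ∀ c : ℝ, 0 < c → ∀ x, c • x ∈ E ↔ x ∈ E) {r : ℝ}
    (hr0 : 0 < r) (hr1 : r < 1) :
    ENNReal.ofReal (1 - r) * Measure.pi (fun _ : Fin n => muP p) E ≤
      uniformLpBall n p (E ∩ {x | r ^ p < lpSum p x}) := by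
  have hs : 0 < r ^ p := Real.rpow_pos_of_pos hr0 p
  have hm : MeasurableSet {x : Fin n → ℝ | lpSum p x ≤ r ^ p} :=
    measurableSet_le measurable_lpSum measurable_const
  have hm' : MeasurableSet {x : Fin n → ℝ | r ^ p < lpSum p x} :=
    measurableSet_lt measurable_const measurable_lpSum
  obtain ⟨hv0, hvt⟩ := volume_lpBall_ne (n := n) hp
  rw [← uniformLpBall_eq_pi_muP hp hE hinv]
  unfold uniformLpBall
  rw [Measure.smul_apply, Measure.smul_apply, Measure.restrict_apply hE,
    Measure.restrict_apply (hE.inter hm'), smul_eq_mul, smul_eq_mul, mul_left_comm]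
  gcongr
  have h1 := volume_inter_lpSum_le hp hinv hs
  have hrr : (r ^ p) ^ (1 / p) = r := by
    rw [← Real.rpow_mul hr0.le, mul_one_div_cancel hp.ne', Real.rpow_one]
  rw [hrr] at h1
  have hcov : E ∩ lpBall n p ⊆
      (E ∩ {x | lpSum p x ≤ r ^ p}) ∪ (E ∩ {x | r ^ p < lpSum p x} ∩ lpBall n p) := by
    intro x hx
    rcases le_or_gt (lpSum p x) (r ^ p) with h | h
    · exact Or.inl ⟨hx.1, h⟩
    · exact Or.inr ⟨⟨hx.1, h⟩, hx.2⟩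
  set V := volume (E ∩ lpBall n p) with hV
  have hVt : V ≠ ⊤ := measure_ne_top_of_subset inter_subset_right hvt
  have h2 : V ≤ ENNReal.ofReal (r ^ n) * V +
      volume (E ∩ {x | r ^ p < lpSum p x} ∩ lpBall n p) := by
    rw [← h1]
    exact (measure_mono hcov).trans (measure_union_le _ _)
  have h3 : ENNReal.ofReal (r ^ n) ≤ ENNReal.ofReal r :=
    ENNReal.ofReal_le_ofReal (pow_le_of_le_one hr0.le hr1.le hn.ne')
  have h4 : V ≤ ENNReal.ofReal r * V + volume (E ∩ {x | r ^ p < lpSum p x} ∩ lpBall n p) :=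
    h2.trans (by gcongr)
  rw [ENNReal.ofReal_sub _ hr0.le, ENNReal.ofReal_one, ENNReal.sub_mul (fun _ _ => hVt), one_mul]
  exact tsub_le_iff_left.2 h4

end LpBall

section UniformSphere

variable {n : ℕ}

/-- The Euclidean norm on `Fin n → ℝ`. -/
def euclNorm (x : Fin n → ℝ) : ℝ := √(∑ i, x i ^ 2)

lemma measurable_euclNorm : Measurable (euclNorm : (Fin n → ℝ) → ℝ) := by
  unfold euclNorm; fun_prop

lemma euclNorm_sq (x : Fin n → ℝ) : euclNorm x ^ 2 = ∑ i, x i ^ 2 :=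
  Real.sq_sqrt (Finset.sum_nonneg fun i _ => sq_nonneg (x i))

lemma euclNorm_nonneg (x : Fin n → ℝ) : 0 ≤ euclNorm x := Real.sqrt_nonneg _

lemma dotp_eq_dotProduct (x y : Fin n → ℝ) : dotp x y = x ⬝ᵥ y := rfl

lemma sum_sq_eq_dotProduct (x : Fin n → ℝ) : ∑ i, x i ^ 2 = x ⬝ᵥ x := by
  simp [dotProduct, sq]

lemma measurable_dotp_right (x : Fin n → ℝ) : Measurable (dotp x) := by
  unfold dotp; fun_prop

lemma measurable_dotp : Measurable fun q : (Fin n → ℝ) × (Fin n → ℝ) => dotp q.1 q.2 := by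
  unfold dotp; fun_prop

/-- Two vectors of equal Euclidean norm are exchanged by a symmetric orthogonal matrix. -/
lemma exists_orthogonal_symm_mulVec {x y : Fin n → ℝ} (h : ∑ i, x i ^ 2 = ∑ i, y i ^ 2) :
    ∃ O : Matrix.orthogonalGroup (Fin n) ℝ, (O : Matrix (Fin n) (Fin n) ℝ).transpose = O ∧
      (O : Matrix (Fin n) (Fin n) ℝ).mulVec x = y := by
  rcases eq_or_ne x y with rfl | hxy
  · exact ⟨1, by simp, by simp⟩
  rw [sum_sq_eq_dotProduct, sum_sq_eq_dotProduct] at h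
  set v := x - y with hv
  have hvv : v ⬝ᵥ v ≠ 0 := fun h0 => hxy (sub_eq_zero.1 (dotProduct_self_eq_zero.1 h0))
  set H : Matrix (Fin n) (Fin n) ℝ := 1 - (2 / (v ⬝ᵥ v)) • Matrix.vecMulVec v v with hH
  have hsym : H.transpose = H := by
    rw [hH, Matrix.transpose_sub, Matrix.transpose_one, Matrix.transpose_smul,
      Matrix.transpose_vecMulVec]
  have hHH : H * H = 1 := by
    rw [hH, sub_mul, mul_sub, one_mul, mul_sub, mul_one, one_mul, Matrix.smul_mul, Matrix.mul_smul,
      Matrix.vecMulVec_mul_vecMulVec, smul_smul]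
    ext i j
    simp only [Matrix.sub_apply, Matrix.smul_apply, Matrix.vecMulVec_apply, smul_eq_mul,
      Pi.smul_apply]
    field_simp
    ring
  refine ⟨⟨H, ?_⟩, hsym, ?_⟩
  · rw [Matrix.mem_orthogonalGroup_iff, hsym, hHH]
  · have hvx : 2 * (v ⬝ᵥ x) = v ⬝ᵥ v := by
      rw [hv, sub_dotProduct, sub_dotProduct, dotProduct_sub, dotProduct_sub, dotProduct_comm y x,
        h]
      ring
    simp only [hH, Matrix.sub_mulVec, Matrix.one_mulVec, Matrix.smul_mulVec,
      Matrix.vecMulVec_mulVec]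
    have h1 : 2 / (v ⬝ᵥ v) * (v ⬝ᵥ x) = 1 := by
      rw [div_mul_eq_mul_div, hvx, div_self hvv]
    ext i
    have h2 : v i = x i - y i := rfl
    simp only [Pi.sub_apply, Pi.smul_apply, smul_eq_mul, MulOpposite.smul_eq_mul_unop,
      MulOpposite.unop_op]
    linear_combination (-v i) * h1 - h2

lemma sphere_dotp_congr {σ : Measure (Fin n → ℝ)} (hσ : IsUniformSphere σ) {A : Set ℝ}
    (hA : MeasurableSet A) {x y : Fin n → ℝ} (h : ∑ i, x i ^ 2 = ∑ i, y i ^ 2) :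
    σ {θ | dotp x θ ∈ A} = σ {θ | dotp y θ ∈ A} := by
  obtain ⟨O, hO, rfl⟩ := exists_orthogonal_symm_mulVec h
  conv_lhs => rw [← hσ.2.2 O]
  have hs : MeasurableSet {θ | dotp x θ ∈ A} := measurable_dotp_right x hA
  rw [Measure.map_apply (by fun_prop) hs]
  congr 1
  ext θ
  simp only [mem_preimage, mem_ofPred_eq, dotp_eq_dotProduct]
  rw [Matrix.dotProduct_mulVec, ← Matrix.mulVec_transpose, hO]

/-- One-dimensional projections of two rotation invariant probability measures on the sphere have
the same law. -/
lemma sphere_dotp_unique {σ₁ σ₂ : Measure (Fin n → ℝ)} (h₁ : IsUniformSphere σ₁)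
    (h₂ : IsUniformSphere σ₂) {A : Set ℝ} (hA : MeasurableSet A) (x : Fin n → ℝ) :
    σ₁ {θ | dotp x θ ∈ A} = σ₂ {θ | dotp x θ ∈ A} := by
  have := h₁.1
  have := h₂.1
  have hae : ∀ {σ : Measure (Fin n → ℝ)}, IsUniformSphere σ → ∀ᵐ θ ∂σ, ∑ i, θ i ^ 2 = 1 := by
    intro σ hσ
    have := hσ.1
    have hm : MeasurableSet (unitSphereSet n) :=
      measurableSet_eq_fun (by fun_prop) measurable_const
    exact (prob_compl_eq_zero_iff hm).2 hσ.2.1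
  have hkey : ∀ {σ τ : Measure (Fin n → ℝ)}, IsUniformSphere σ → IsUniformSphere τ →
      ∫⁻ y, σ {θ | dotp (euclNorm x • y) θ ∈ A} ∂τ = σ {θ | dotp x θ ∈ A} := by
    intro σ τ hσ hτ
    have := hτ.1
    rw [lintegral_congr_ae (g := fun _ => σ {θ | dotp x θ ∈ A}), lintegral_const, measure_univ,
      mul_one]
    filter_upwards [hae hτ] with y hy
    refine sphere_dotp_congr hσ hA ?_
    simp only [Pi.smul_apply, smul_eq_mul, mul_pow]
    rw [← Finset.mul_sum, hy, mul_one, euclNorm_sq]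
  rw [← hkey h₁ h₂, ← hkey h₂ h₁]
  have hmeas : MeasurableSet {q : (Fin n → ℝ) × (Fin n → ℝ) | dotp (euclNorm x • q.1) q.2 ∈ A} := by
    have h : Measurable fun q : (Fin n → ℝ) × (Fin n → ℝ) => dotp (euclNorm x • q.1) q.2 := by
      unfold dotp; fun_prop
    exact h hA
  have e1 := Measure.prod_apply (μ := σ₂) (ν := σ₁) hmeas
  have e2 := Measure.prod_apply_symm (μ := σ₂) (ν := σ₁) hmeas
  rw [e1] at e2
  refine e2.trans (lintegral_congr fun y => ?_)
  congr 1
  ext θ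
  simp only [mem_preimage, mem_ofPred_eq, dotp_eq_dotProduct, smul_dotProduct]
  rw [dotProduct_comm]

/-- The standard Gaussian measure on `Fin n → ℝ`. -/
def stdGaussianPi (n : ℕ) : Measure (Fin n → ℝ) := Measure.pi fun _ => muP 2

lemma isProbabilityMeasure_stdGaussianPi (n : ℕ) : IsProbabilityMeasure (stdGaussianPi n) := by
  have := isProbabilityMeasure_muP (two_pos (α := ℝ))
  unfold stdGaussianPi
  infer_instance

lemma sum_sq_mulVec (O : Matrix.orthogonalGroup (Fin n) ℝ) (x : Fin n → ℝ) :
    ∑ i, (O : Matrix (Fin n) (Fin n) ℝ).mulVec x i ^ 2 = ∑ i, x i ^ 2 := by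
  rw [sum_sq_eq_dotProduct, sum_sq_eq_dotProduct, Matrix.dotProduct_mulVec, Matrix.vecMul_mulVec]
  have h : (O : Matrix (Fin n) (Fin n) ℝ).transpose * (O : Matrix (Fin n) (Fin n) ℝ) = 1 :=
    (Matrix.mem_orthogonalGroup_iff' (Fin n) ℝ).1 O.2
  rw [h, Matrix.vecMul_one]

lemma map_mulVec_stdGaussianPi (O : Matrix.orthogonalGroup (Fin n) ℝ) :
    (stdGaussianPi n).map (fun x => (O : Matrix (Fin n) (Fin n) ℝ).mulVec x) =
      stdGaussianPi n := by
  have hdet : |(O : Matrix (Fin n) (Fin n) ℝ).det| = 1 := by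
    have h : (O : Matrix (Fin n) (Fin n) ℝ) * (O : Matrix (Fin n) (Fin n) ℝ).transpose = 1 :=
      (Matrix.mem_orthogonalGroup_iff (Fin n) ℝ).1 O.2
    have h2 := congrArg Matrix.det h
    rw [Matrix.det_mul, Matrix.det_transpose, Matrix.det_one] at h2
    rcases mul_self_eq_one_iff.1 h2 with h | h <;> simp [h]
  have hdet0 : (O : Matrix (Fin n) (Fin n) ℝ).det ≠ 0 := fun h => by simp [h] at hdet
  have hvol := Real.map_matrix_volume_pi_eq_smul_volume_pi hdet0
  rw [abs_inv, hdet, inv_one, ENNReal.ofReal_one, one_smul] at hvol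
  have hm : Measurable fun x : Fin n → ℝ => (O : Matrix (Fin n) (Fin n) ℝ).mulVec x := by fun_prop
  have hsum : ∀ x : Fin n → ℝ, lpSum 2 x = ∑ i, x i ^ 2 := fun x => by simp [lpSum]
  have hd : Measurable fun x : Fin n → ℝ =>
      ENNReal.ofReal (muPConst 2 ^ n) * ENNReal.ofReal (Real.exp (-(1 / 2) * lpSum 2 x)) :=
    ((Real.measurable_exp.comp (measurable_lpSum.const_mul _)).ennreal_ofReal).const_mul _
  ext s hs
  unfold stdGaussianPi
  rw [Measure.map_apply hm hs, pi_muP_eq two_pos, withDensity_apply _ (hm hs),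
    withDensity_apply _ hs]
  conv_rhs => rw [← hvol]
  rw [setLIntegral_map hs hd (by fun_prop)]
  refine lintegral_congr fun x => ?_
  rw [hsum, hsum, Matrix.toLin'_apply, sum_sq_mulVec]

lemma ae_euclNorm_pos (hn : 0 < n) : ∀ᵐ z ∂(stdGaussianPi n), 0 < euclNorm z := by
  have := isProbabilityMeasure_muP (two_pos (α := ℝ))
  have h : ∀ᵐ z ∂(stdGaussianPi n), z ⟨0, hn⟩ ≠ 0 :=
    (Measure.quasiMeasurePreserving_eval (fun _ : Fin n => muP 2) ⟨0, hn⟩).ae (ae_muP_ne_zero 2)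
  filter_upwards [h] with z hz
  refine Real.sqrt_pos.2 (lt_of_lt_of_le (by positivity : 0 < z ⟨0, hn⟩ ^ 2) ?_)
  exact Finset.single_le_sum (f := fun i => z i ^ 2) (fun i _ => sq_nonneg _) (Finset.mem_univ _)

lemma isUniformSphere_map_normalize (hn : 0 < n) :
    IsUniformSphere ((stdGaussianPi n).map fun z => (euclNorm z)⁻¹ • z) := by
  have := isProbabilityMeasure_stdGaussianPi n
  have hm : Measurable fun z : Fin n → ℝ => (euclNorm z)⁻¹ • z :=
    measurable_euclNorm.inv.smul measurable_id
  have hs : MeasurableSet (unitSphereSet n) := measurableSet_eq_fun (by fun_prop) measurable_const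
  refine ⟨Measure.isProbabilityMeasure_map hm.aemeasurable, ?_, fun O => ?_⟩
  · rw [Measure.map_apply hm hs, ← prob_compl_eq_zero_iff (hm hs)]
    change ∀ᵐ z ∂(stdGaussianPi n), (euclNorm z)⁻¹ • z ∈ unitSphereSet n
    filter_upwards [ae_euclNorm_pos hn] with z hz
    change ∑ i, ((euclNorm z)⁻¹ * z i) ^ 2 = 1
    simp only [mul_pow]
    rw [← Finset.mul_sum, ← euclNorm_sq]
    field_simp
  · have hO : Measurable fun x : Fin n → ℝ => (O : Matrix (Fin n) (Fin n) ℝ).mulVec x := by fun_prop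
    conv_rhs => rw [← map_mulVec_stdGaussianPi O]
    rw [Measure.map_map hO hm, Measure.map_map hm hO]
    congr 1
    ext z
    simp only [Function.comp]
    rw [Matrix.mulVec_smul]
    unfold euclNorm
    rw [sum_sq_mulVec]

/-- Gaussian representation of one-dimensional projections of the uniform law on the sphere. -/
lemma sphere_dotp_eq_stdGaussianPi (hn : 0 < n) {σ : Measure (Fin n → ℝ)} (hσ : IsUniformSphere σ)
    {A : Set ℝ} (hA : MeasurableSet A) (x : Fin n → ℝ) :
    σ {θ | dotp x θ ∈ A} = stdGaussianPi n {z | (euclNorm z)⁻¹ * dotp x z ∈ A} := by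
  have hm : Measurable fun z : Fin n → ℝ => (euclNorm z)⁻¹ • z :=
    measurable_euclNorm.inv.smul measurable_id
  have hs : MeasurableSet {θ | dotp x θ ∈ A} := measurable_dotp_right x hA
  rw [sphere_dotp_unique hσ (isUniformSphere_map_normalize hn) hA x, Measure.map_apply hm hs]
  congr 1
  ext z
  simp [dotp_eq_dotProduct]

end UniformSphere

section Combination

variable {n : ℕ} {p : ℝ}

/-- The empirical mean of the statistic `projStat p` over the coordinates of a pair of vectors. -/
def pairMean (p : ℝ) (q : (Fin n → ℝ) × (Fin n → ℝ)) : Fin 3 → ℝ :=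
  empMean fun i => projStat p (q.1 i, q.2 i)

lemma measurable_pairMean : Measurable (pairMean p : (Fin n → ℝ) × (Fin n → ℝ) → Fin 3 → ℝ) :=
  measurable_empMean.comp <| measurable_pi_lambda _ fun i => (measurable_projStat p).comp <|
    ((measurable_pi_apply i).comp measurable_fst).prodMk
      ((measurable_pi_apply i).comp measurable_snd)

lemma pi_projLaw_empMean (hp : 0 < p) {S : Set (Fin 3 → ℝ)} (hS : MeasurableSet S) :
    Measure.pi (fun _ : Fin n => projLaw p) {x | empMean x ∈ S} =
      ((Measure.pi fun _ : Fin n => muP p).prod (stdGaussianPi n)) {q | pairMean p q ∈ S} := by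
  have := isProbabilityMeasure_muP hp
  have := isProbabilityMeasure_muP (two_pos (α := ℝ))
  have := isProbabilityMeasure_projLaw hp
  have hmp := measurePreserving_arrowProdEquivProdArrow ℝ ℝ (Fin n) (fun _ => muP p)
    (fun _ => muP 2)
  have hS' : MeasurableSet {q : (Fin n → ℝ) × (Fin n → ℝ) | pairMean p q ∈ S} :=
    measurable_pairMean hS
  have hS'' : MeasurableSet {x : Fin n → Fin 3 → ℝ | empMean x ∈ S} := measurable_empMean hS
  have hpi : Measure.pi (fun _ : Fin n => projLaw p) =
      (Measure.pi fun _ : Fin n => (muP p).prod (muP 2)).map fun x i => projStat p (x i) :=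
    (Measure.pi_map_pi (f := fun _ => projStat p)
      (hμ := fun _ => by change SigmaFinite (projLaw p); infer_instance)
      fun _ => (measurable_projStat p).aemeasurable).symm
  have hm : Measurable fun (x : Fin n → ℝ × ℝ) i => projStat p (x i) :=
    measurable_pi_lambda _ fun i => (measurable_projStat p).comp (measurable_pi_apply i)
  unfold stdGaussianPi
  rw [hpi, Measure.map_apply hm hS'', ← hmp.measure_preimage hS'.nullMeasurableSet]
  rfl

lemma pairMean_zero (q : (Fin n → ℝ) × (Fin n → ℝ)) :
    pairMean p q 0 = (n : ℝ)⁻¹ * euclNorm q.2 ^ 2 := by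
  simp [pairMean, empMean, projStat, euclNorm_sq]

lemma pairMean_two (q : (Fin n → ℝ) × (Fin n → ℝ)) :
    pairMean p q 2 = (n : ℝ)⁻¹ * lpSum p q.1 := by
  simp [pairMean, empMean, projStat, lpSum]

lemma pairMean_one (hn : 0 < n) (q : (Fin n → ℝ) × (Fin n → ℝ)) :
    pairMean p q 1 = (n : ℝ) ^ (-(1 / 2 + 1 / p)) * ((n : ℝ) ^ (1 / p - 1 / 2) * dotp q.1 q.2) := by
  have h : pairMean p q 1 = (n : ℝ)⁻¹ * dotp q.1 q.2 := by
    simp [pairMean, empMean, projStat, dotp, mul_comm]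
  rw [h, ← mul_assoc, ← Real.rpow_add (by positivity), ← Real.rpow_neg_one]
  congr 2
  ring

lemma pairMean_zero_mul_two (hn : 0 < n) (q : (Fin n → ℝ) × (Fin n → ℝ)) :
    pairMean p q 0 ^ ((1 : ℝ) / 2) * pairMean p q 2 ^ ((1 : ℝ) / p) =
      (n : ℝ) ^ (-(1 / 2 + 1 / p)) * (euclNorm q.2 * lpSum p q.1 ^ (1 / p)) := by
  have hn' : (0 : ℝ) < n := by exact_mod_cast hn
  rw [pairMean_zero, pairMean_two, Real.mul_rpow (by positivity) (by positivity),
    Real.mul_rpow (by positivity) (lpSum_nonneg _), ← Real.sqrt_eq_rpow (euclNorm q.2 ^ 2),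
    Real.sqrt_sq (euclNorm_nonneg _), neg_add, Real.rpow_add hn', Real.inv_rpow hn'.le,
    Real.inv_rpow hn'.le, Real.rpow_neg hn'.le, Real.rpow_neg hn'.le]
  ring

lemma pairMean_mem_quotTail (hn : 0 < n) (a : ℝ) (q : (Fin n → ℝ) × (Fin n → ℝ)) :
    pairMean p q ∈ quotTail p a ↔
      a * (euclNorm q.2 * lpSum p q.1 ^ (1 / p)) ≤ |(n : ℝ) ^ (1 / p - 1 / 2) * dotp q.1 q.2| := by
  have hk : 0 < (n : ℝ) ^ (-(1 / 2 + 1 / p)) := by positivity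
  have h0 : 0 ≤ pairMean p q 0 := by rw [pairMean_zero]; positivity
  have h2 : 0 ≤ pairMean p q 2 := by
    rw [pairMean_two]; exact mul_nonneg (by positivity) (lpSum_nonneg _)
  simp only [quotTail, mem_ofPred_eq, h0, h2, true_and]
  rw [pairMean_zero_mul_two hn, pairMean_one hn, abs_mul, abs_of_pos hk, mul_left_comm,
    mul_le_mul_iff_right₀ hk]

/-- The vectors `x ∈ ℝ³` whose quotient `projQuot p x` is within `ε` of `w`. -/
def quotNear (p w ε : ℝ) : Set (Fin 3 → ℝ) :=
  {x | 0 < x 0 ∧ 0 < x 2 ∧ |x 1 - w * (x 0 ^ ((1 : ℝ) / 2) * x 2 ^ ((1 : ℝ) / p))| <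
    ε * (x 0 ^ ((1 : ℝ) / 2) * x 2 ^ ((1 : ℝ) / p))}

lemma isOpen_quotNear (hp : 0 < p) (w ε : ℝ) : IsOpen (quotNear p w ε) := by
  have h0 : Continuous fun x : Fin 3 → ℝ => x 0 ^ ((1 : ℝ) / 2) * x 2 ^ ((1 : ℝ) / p) :=
    ((continuous_apply 0).rpow_const fun _ => Or.inr (by positivity)).mul
      ((continuous_apply 2).rpow_const fun _ => Or.inr (by positivity))
  refine (isOpen_lt continuous_const (continuous_apply 0)).inter
    ((isOpen_lt continuous_const (continuous_apply 2)).inter ?_)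
  exact isOpen_lt ((continuous_apply 1).sub (continuous_const.mul h0)).abs
    (continuous_const.mul h0)

lemma pairMean_mem_quotNear (hn : 0 < n) (w ε : ℝ) (q : (Fin n → ℝ) × (Fin n → ℝ)) :
    pairMean p q ∈ quotNear p w ε ↔ 0 < euclNorm q.2 ∧ 0 < lpSum p q.1 ∧
      |(n : ℝ) ^ (1 / p - 1 / 2) * dotp q.1 q.2 - w * (euclNorm q.2 * lpSum p q.1 ^ (1 / p))| <
        ε * (euclNorm q.2 * lpSum p q.1 ^ (1 / p)) := by
  have hk : 0 < (n : ℝ) ^ (-(1 / 2 + 1 / p)) := by positivity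
  have hn' : 0 < (n : ℝ)⁻¹ := by positivity
  have h0 : 0 < pairMean p q 0 ↔ 0 < euclNorm q.2 := by
    rw [pairMean_zero, mul_pos_iff_of_pos_left hn', sq_pos_iff,
      (euclNorm_nonneg q.2).lt_iff_ne']
  have h2 : 0 < pairMean p q 2 ↔ 0 < lpSum p q.1 := by
    rw [pairMean_two, mul_pos_iff_of_pos_left hn']
  simp only [quotNear, mem_ofPred_eq, h0, h2]
  rw [pairMean_zero_mul_two hn, pairMean_one hn, mul_left_comm w, mul_left_comm ε, ← mul_sub,
    abs_mul, abs_of_pos hk, mul_lt_mul_iff_right₀ hk]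

lemma isProbabilityMeasure_uniformLpBall (hp : 0 < p) :
    IsProbabilityMeasure (uniformLpBall n p) := by
  have h := volume_lpBall_ne (n := n) hp
  refine ⟨?_⟩
  simp only [uniformLpBall, Measure.smul_apply, smul_eq_mul, Measure.restrict_apply_univ]
  exact ENNReal.inv_mul_cancel h.1 h.2

lemma ae_uniformLpBall_lpSum_le : ∀ᵐ x ∂(uniformLpBall n p), lpSum p x ≤ 1 :=
  Measure.ae_smul_measure (ae_restrict_mem measurableSet_lpBall) _

/-- Gaussian representation of the law of the scaled random projection. -/
lemma measure_scaled_dotp {Ω : Type*} [MeasurableSpace Ω] {P : Measure Ω} [IsProbabilityMeasure P]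
    (hn : 0 < n) {X Θ : Ω → (Fin n → ℝ)} (hXm : Measurable X) (hΘm : Measurable Θ)
    (hX : P.map X = uniformLpBall n p) (hΘ : IsUniformSphere (P.map Θ)) (hi : IndepFun X Θ P)
    (κ : ℝ) {A : Set ℝ} (hA : MeasurableSet A) :
    P {ω | κ * dotp (X ω) (Θ ω) ∈ A} = ((uniformLpBall n p).prod (stdGaussianPi n))
      {q | κ * ((euclNorm q.2)⁻¹ * dotp q.1 q.2) ∈ A} := by
  have hu : IsProbabilityMeasure (uniformLpBall n p) :=
    hX ▸ Measure.isProbabilityMeasure_map hXm.aemeasurable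
  have := isProbabilityMeasure_stdGaussianPi n
  have := hΘ.1
  have hA' : MeasurableSet {t | κ * t ∈ A} := (measurable_const_mul κ) hA
  have hs : MeasurableSet {q : (Fin n → ℝ) × (Fin n → ℝ) | κ * dotp q.1 q.2 ∈ A} :=
    measurable_dotp hA'
  have hs' : MeasurableSet {q : (Fin n → ℝ) × (Fin n → ℝ) |
      κ * ((euclNorm q.2)⁻¹ * dotp q.1 q.2) ∈ A} :=
    ((measurable_euclNorm.comp measurable_snd).inv.mul measurable_dotp) hA'
  have h1 : P {ω | κ * dotp (X ω) (Θ ω) ∈ A} =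
      P.map (fun ω => (X ω, Θ ω)) {q | κ * dotp q.1 q.2 ∈ A} :=
    (Measure.map_apply (hXm.prodMk hΘm) hs).symm
  rw [h1, (indepFun_iff_map_prod_eq_prod_map_map hXm.aemeasurable hΘm.aemeasurable).1 hi, hX,
    Measure.prod_apply hs, Measure.prod_apply hs']
  exact lintegral_congr fun x => sphere_dotp_eq_stdGaussianPi hn hΘ hA' x

lemma euclNorm_mul_lpSum_smul (hp : 0 < p) {c : ℝ} (hc : 0 < c) (x z : Fin n → ℝ) :
    euclNorm z * lpSum p (c • x) ^ (1 / p) = c * (euclNorm z * lpSum p x ^ (1 / p)) := by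
  rw [lpSum_smul hc.le, Real.mul_rpow (by positivity) (lpSum_nonneg x), ← Real.rpow_mul hc.le,
    mul_one_div_cancel hp.ne', Real.rpow_one]
  ring

lemma dotp_smul_left (c : ℝ) (x z : Fin n → ℝ) : dotp (c • x) z = c * dotp x z := by
  simp [dotp_eq_dotProduct]

lemma prod_abs_ge_le (hp : 0 < p) (hn : 0 < n) {a : ℝ} (ha : 0 ≤ a) :
    ((uniformLpBall n p).prod (stdGaussianPi n))
        {q | a ≤ |(n : ℝ) ^ (1 / p - 1 / 2) * ((euclNorm q.2)⁻¹ * dotp q.1 q.2)|} ≤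
      Measure.pi (fun _ : Fin n => projLaw p) {x | empMean x ∈ quotTail p a} := by
  have := isProbabilityMeasure_uniformLpBall (n := n) hp
  have := isProbabilityMeasure_stdGaussianPi n
  have := isProbabilityMeasure_muP hp
  have hU : MeasurableSet (quotTail p a) := (isClosed_quotTail hp a).measurableSet
  have hU' : MeasurableSet {q : (Fin n → ℝ) × (Fin n → ℝ) | pairMean p q ∈ quotTail p a} :=
    measurable_pairMean hU
  have hs : MeasurableSet {q : (Fin n → ℝ) × (Fin n → ℝ) |
      a ≤ |(n : ℝ) ^ (1 / p - 1 / 2) * ((euclNorm q.2)⁻¹ * dotp q.1 q.2)|} :=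
    measurableSet_le measurable_const
      (((measurable_euclNorm.comp measurable_snd).inv.mul measurable_dotp).const_mul _).abs
  rw [pi_projLaw_empMean hp hU, Measure.prod_apply_symm hs, Measure.prod_apply_symm hU']
  refine lintegral_mono fun z => ?_
  rw [← uniformLpBall_eq_pi_muP hp (measurable_prodMk_right hU')]
  · refine measure_mono_ae ?_
    filter_upwards [ae_uniformLpBall_lpSum_le (n := n) (p := p)] with x hx hxa
    change pairMean p (x, z) ∈ quotTail p a
    have hxa : a ≤ |(n : ℝ) ^ (1 / p - 1 / 2) * ((euclNorm z)⁻¹ * dotp x z)| := hxa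
    rw [pairMean_mem_quotTail hn]
    have hL : lpSum p x ^ (1 / p) ≤ 1 := Real.rpow_le_one (lpSum_nonneg x) hx (by positivity)
    rcases (euclNorm_nonneg z).eq_or_lt with h | h
    · rw [← h, zero_mul, mul_zero]
      exact abs_nonneg _
    · have h1 : |(n : ℝ) ^ (1 / p - 1 / 2) * dotp x z| =
          |(n : ℝ) ^ (1 / p - 1 / 2) * ((euclNorm z)⁻¹ * dotp x z)| * euclNorm z := by
        rw [← abs_of_pos h, ← abs_mul, abs_of_pos h]
        congr 1
        field_simp
      rw [h1]
      calc a * (euclNorm z * lpSum p x ^ (1 / p)) ≤ a * (euclNorm z * 1) := by gcongr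
        _ ≤ _ := by rw [mul_one]; gcongr
  · intro c hc x
    change pairMean p (c • x, z) ∈ quotTail p a ↔ pairMean p (x, z) ∈ quotTail p a
    rw [pairMean_mem_quotTail hn, pairMean_mem_quotTail hn]
    simp only
    rw [euclNorm_mul_lpSum_smul hp hc, dotp_smul_left, mul_left_comm, mul_left_comm _ c, abs_mul c,
      abs_of_pos hc, mul_le_mul_iff_right₀ hc]

lemma le_prod_near (hp : 0 < p) (hn : 0 < n) {w ε r : ℝ} (hr0 : 0 < r) (hr1 : r < 1) {A : Set ℝ}
    (hA : MeasurableSet A)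
    (hrA : ∀ s, r < s → s ≤ 1 → ∀ v, |v - w| < ε → s * v ∈ A) :
    ENNReal.ofReal (1 - r) *
        Measure.pi (fun _ : Fin n => projLaw p) {x | empMean x ∈ quotNear p w ε} ≤
      ((uniformLpBall n p).prod (stdGaussianPi n))
        {q | (n : ℝ) ^ (1 / p - 1 / 2) * ((euclNorm q.2)⁻¹ * dotp q.1 q.2) ∈ A} := by
  have := isProbabilityMeasure_uniformLpBall (n := n) hp
  have := isProbabilityMeasure_stdGaussianPi n
  have := isProbabilityMeasure_muP hp
  have hU : MeasurableSet (quotNear p w ε) := (isOpen_quotNear hp w ε).measurableSet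
  have hU' : MeasurableSet {q : (Fin n → ℝ) × (Fin n → ℝ) | pairMean p q ∈ quotNear p w ε} :=
    measurable_pairMean hU
  have hs : MeasurableSet {q : (Fin n → ℝ) × (Fin n → ℝ) |
      (n : ℝ) ^ (1 / p - 1 / 2) * ((euclNorm q.2)⁻¹ * dotp q.1 q.2) ∈ A} :=
    (((measurable_euclNorm.comp measurable_snd).inv.mul measurable_dotp).const_mul _) hA
  rw [pi_projLaw_empMean hp hU, Measure.prod_apply_symm hs, Measure.prod_apply_symm hU',
    ← lintegral_const_mul _ (measurable_measure_prodMk_right hU')]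
  refine lintegral_mono fun z => ?_
  refine (le_uniformLpBall_inter hp hn (measurable_prodMk_right hU') ?_ hr0 hr1).trans ?_
  · intro c hc x
    change pairMean p (c • x, z) ∈ quotNear p w ε ↔ pairMean p (x, z) ∈ quotNear p w ε
    rw [pairMean_mem_quotNear hn, pairMean_mem_quotNear hn]
    simp only
    rw [euclNorm_mul_lpSum_smul hp hc, dotp_smul_left, mul_left_comm w, mul_left_comm _ c,
      mul_left_comm ε, ← mul_sub, abs_mul c, abs_of_pos hc, mul_lt_mul_iff_right₀ hc,
      lpSum_smul hc.le, mul_pos_iff_of_pos_left (by positivity)]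
  · refine measure_mono_ae ?_
    filter_upwards [ae_uniformLpBall_lpSum_le (n := n) (p := p)] with x hx hxa
    have hxU : pairMean p (x, z) ∈ quotNear p w ε := hxa.1
    have hxr : r ^ p < lpSum p x := hxa.2
    obtain ⟨hN, hL, hlt⟩ := (pairMean_mem_quotNear hn w ε (x, z)).1 hxU
    simp only at hN hL hlt
    change (n : ℝ) ^ (1 / p - 1 / 2) * ((euclNorm z)⁻¹ * dotp x z) ∈ A
    have hs0 : 0 < lpSum p x ^ (1 / p) := by positivity
    have hs1 : lpSum p x ^ (1 / p) ≤ 1 := Real.rpow_le_one hL.le hx (by positivity)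
    have hrs : r < lpSum p x ^ (1 / p) := by
      rw [one_div, Real.lt_rpow_inv_iff_of_pos hr0.le hL.le hp]
      exact hxr
    have hD := mul_pos hN hs0
    have := hrA _ hrs hs1
      ((n : ℝ) ^ (1 / p - 1 / 2) * dotp x z / (euclNorm z * lpSum p x ^ (1 / p))) (by
        rwa [← mul_lt_mul_iff_left₀ hD, ← abs_of_pos hD, ← abs_mul, abs_of_pos hD, sub_mul,
          div_mul_cancel₀ _ hD.ne'])
    convert this using 1
    field_simp

end Combination

section Rates

lemma log_ofReal_mul_exp {K : ℝ} (hK : 0 < K) {n : ℕ} (hn : 0 < n) (c : ℝ) :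
    (((n : ℝ)⁻¹ : ℝ) : EReal) * ENNReal.log (ENNReal.ofReal (K * Real.exp (-(n * c)))) =
      (((n : ℝ)⁻¹ * Real.log K - c : ℝ) : EReal) := by
  have hn' : (n : ℝ) ≠ 0 := by positivity
  rw [ENNReal.log_ofReal_of_pos (by positivity), Real.log_mul hK.ne' (Real.exp_pos _).ne',
    Real.log_exp, ← EReal.coe_mul]
  congr 1
  field_simp
  ring

lemma tendsto_inv_mul_log_sub (K c : ℝ) :
    Tendsto (fun n : ℕ => (((n : ℝ)⁻¹ * Real.log K - c : ℝ) : EReal)) atTop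
      (𝓝 ((-c : ℝ) : EReal)) := by
  refine EReal.tendsto_coe.2 ?_
  simpa using ((tendsto_inv_atTop_nhds_zero_nat (𝕜 := ℝ)).mul_const (Real.log K)).sub_const c

lemma limsup_inv_mul_log_le {u : ℕ → ℝ≥0∞} {K c : ℝ} (hK : 0 < K)
    (h : ∀ᶠ n : ℕ in atTop, u n ≤ ENNReal.ofReal (K * Real.exp (-(n * c)))) :
    (atTop.limsup fun n : ℕ => (((n : ℝ)⁻¹ : ℝ) : EReal) * ENNReal.log (u n)) ≤
      ((-c : ℝ) : EReal) := by
  rw [← (tendsto_inv_mul_log_sub K c).limsup_eq]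
  refine limsup_le_limsup ?_
  filter_upwards [h, eventually_gt_atTop 0] with n hn hn0
  rw [← log_ofReal_mul_exp hK hn0]
  exact mul_le_mul_of_nonneg_left (ENNReal.log_le_log hn) (by positivity)

lemma le_liminf_inv_mul_log {u : ℕ → ℝ≥0∞} {K c : ℝ} (hK : 0 < K)
    (h : ∀ᶠ n : ℕ in atTop, ENNReal.ofReal (K * Real.exp (-(n * c))) ≤ u n) :
    ((-c : ℝ) : EReal) ≤
      atTop.liminf fun n : ℕ => (((n : ℝ)⁻¹ : ℝ) : EReal) * ENNReal.log (u n) := by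
  rw [← (tendsto_inv_mul_log_sub K c).liminf_eq]
  refine liminf_le_liminf ?_
  filter_upwards [h, eventually_gt_atTop 0] with n hn hn0
  rw [← log_ofReal_mul_exp hK hn0]
  exact mul_le_mul_of_nonneg_left (ENNReal.log_le_log hn) (by positivity)

/-- Exponential upper and lower bounds for closed and open sets imply a large deviation principle
with speed `n`. -/
lemma isLDP_of_exp_bounds {Ω : Type*} [MeasurableSpace Ω] {P : Measure Ω} {ξ : ℕ → Ω → ℝ}
    {I : ℝ → EReal} (hI : LowerSemicontinuous I)
    (hupper : ∀ C : Set ℝ, IsClosed C → ∀ c : ℝ, (c : EReal) < ⨅ x ∈ C, I x → ∃ K : ℝ, 0 < K ∧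
      ∀ᶠ n : ℕ in atTop, P {ω | ξ n ω ∈ C} ≤ ENNReal.ofReal (K * Real.exp (-(n * c))))
    (hlower : ∀ G : Set ℝ, IsOpen G → ∀ w ∈ G, ∀ c : ℝ, I w < c → ∃ K : ℝ, 0 < K ∧
      ∀ᶠ n : ℕ in atTop, ENNReal.ofReal (K * Real.exp (-(n * c))) ≤ P {ω | ξ n ω ∈ G}) :
    IsLDP P ξ (fun n => (n : ℝ)) I := by
  refine ⟨hI, fun Γ _ => ⟨?_, ?_⟩⟩
  · refine EReal.neg_le.1 (le_iInf₂ fun w hw => ?_)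
    by_contra! hlt
    obtain ⟨c, h1, h2⟩ := EReal.lt_iff_exists_real_btwn.1 hlt
    obtain ⟨K, hK, h⟩ := hlower _ isOpen_interior w hw c h1
    have h3 := le_liminf_inv_mul_log hK h
    rw [EReal.coe_neg] at h3
    exact absurd (EReal.neg_le.1 h3) (not_le.2 h2)
  · by_contra! hlt
    obtain ⟨d, h1, h2⟩ := EReal.lt_iff_exists_real_btwn.1 hlt
    obtain ⟨K, hK, h⟩ := hupper _ isClosed_closure (-d) (by
      rw [EReal.coe_neg]; exact EReal.neg_lt_comm.1 h1)
    have h3 := limsup_inv_mul_log_le hK h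
    rw [neg_neg] at h3
    exact absurd h3 (not_le.2 h2)

end Rates

section ScaledProjection

variable {p : ℝ}

/-- A closed set on which the rate exceeds `c ≥ 0` lies in a tail on which the rate exceeds `c`. -/
lemma exists_subset_abs_ge (hp : 2 ≤ p) {C : Set ℝ} (hC : IsClosed C) {c : ℝ} (hc : 0 ≤ c)
    (h : (c : EReal) < ⨅ x ∈ C, Ia p x) (hne : C.Nonempty) :
    ∃ a, 0 < a ∧ (c : EReal) < Ia p a ∧ C ⊆ {t | a ≤ |t|} := by
  obtain ⟨w, hw, hmin⟩ := hC.exists_infDist_eq_dist hne 0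
  have hlt : (c : EReal) < Ia p w := h.trans_le (iInf₂_le w hw)
  have hw0 : w ≠ 0 := by
    rintro rfl
    rw [Ia_zero hp] at hlt
    exact absurd (EReal.coe_nonneg.2 hc) (not_le.2 hlt)
  refine ⟨|w|, abs_pos.2 hw0, hlt.trans_le (Ia_mono_abs hp (by simp)), fun t ht => ?_⟩
  have h1 := Metric.infDist_le_dist_of_mem (x := (0 : ℝ)) ht
  rw [hmin] at h1
  simpa [Real.dist_eq] using h1

lemma exists_mul_mem_of_isOpen {G : Set ℝ} (hG : IsOpen G) {w : ℝ} (hw : w ∈ G) :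
    ∃ r ε : ℝ, 0 < r ∧ r < 1 ∧ 0 < ε ∧
      ∀ s, r < s → s ≤ 1 → ∀ v, |v - w| < ε → s * v ∈ G := by
  have hnhds : (fun q : ℝ × ℝ => q.1 * q.2) ⁻¹' G ∈ 𝓝 ((1 : ℝ), w) :=
    (hG.preimage continuous_mul).mem_nhds (by simpa using hw)
  obtain ⟨δ, hδ, hsub⟩ := Metric.mem_nhds_iff.1 hnhds
  refine ⟨max (1 - δ) (1 / 2), δ, by positivity, max_lt (by linarith) (by norm_num), hδ,
    fun s hs hs1 v hv => ?_⟩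
  have h1 := (le_max_left (1 - δ) (1 / 2)).trans_lt hs
  have hball : (s, v) ∈ Metric.ball ((1 : ℝ), w) δ := by
    rw [Metric.mem_ball, Prod.dist_eq, max_lt_iff, Real.dist_eq, Real.dist_eq, abs_lt]
    exact ⟨⟨by simp only; linarith, by simp only; linarith⟩, hv⟩
  exact hsub hball

lemma mem_quotNear_projQuot {x : Fin 3 → ℝ} (h0 : 0 < x 0) (h2 : 0 < x 2) {ε : ℝ} (hε : 0 < ε) :
    x ∈ quotNear p (projQuot p x) ε := by
  refine ⟨h0, h2, ?_⟩
  rw [(projQuot_eq_iff (p := p) h0 h2 _).1 rfl, sub_self, abs_zero]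
  positivity

lemma eventually_le_pi_quotNear (hp : 2 ≤ p) {w c ε : ℝ} (hε : 0 < ε) (h : Ia p w < c) :
    ∀ᶠ n : ℕ in atTop, ENNReal.ofReal (1 / 2 * Real.exp (-(n * c))) ≤
      Measure.pi (fun _ : Fin n => projLaw p) {x | empMean x ∈ quotNear p w ε} := by
  have hp0 : 0 < p := by linarith
  have := isProbabilityMeasure_projLaw hp0
  obtain ⟨d, hd1, hd2⟩ := EReal.lt_iff_exists_real_btwn.1 h
  have hdc : d < c := EReal.coe_lt_coe_iff.1 hd2
  obtain ⟨x, hx, hxw⟩ := exists_mem_of_Ia_lt hp0 hd1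
  obtain ⟨h0, h2⟩ := pos_of_mem_cramerSublevel_projLaw hp0 hx
  obtain ⟨ρ, hρ, hsub⟩ := Metric.isOpen_iff.1 (isOpen_quotNear hp0 w ε) x
    (hxw ▸ mem_quotNear_projQuot h0 h2 hε)
  filter_upwards [eventually_le_pi_empMean_ball (projLaw p) hx hρ (sub_pos.2 hdc)] with n hn
  rw [add_sub_cancel] at hn
  exact hn.trans (measure_mono fun y hy => hsub (mem_ball_iff_norm.2 hy))

end ScaledProjection

/-- Annealed LDP for `p ∈ [2,∞)`. -/
theorem statement0
    (p : ℝ) (hp : 2 ≤ p)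
    {Ω : Type*} [MeasurableSpace Ω] (P : Measure Ω) [IsProbabilityMeasure P]
    (X Θ : (n : ℕ) → Ω → (Fin n → ℝ))
    (hXmeas : ∀ n, Measurable (X n)) (hΘmeas : ∀ n, Measurable (Θ n))
    (hX : ∀ n, 0 < n → Measure.map (X n) P = uniformLpBall n p)
    (hΘ : ∀ n, 0 < n → IsUniformSphere (Measure.map (Θ n) P))
    (hIndep : ∀ n, IndepFun (X n) (Θ n) P) :
    IsLDP P (fun n ω => (n : ℝ) ^ (1/p - 1/2 : ℝ) * dotp (X n ω) (Θ n ω))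
      (fun n => (n : ℝ)) (Ia p)
    ∧ (∀ w : ℝ, 0 ≤ Ia p w)
    ∧ HasCompactSublevels (Ia p)
    ∧ QuasiconvexRate (Ia p)
    ∧ SymmetricRate (Ia p) := by
  have hp0 : 0 < p := by linarith
  refine ⟨isLDP_of_exp_bounds (lowerSemicontinuous_Ia hp) ?_ ?_, Ia_nonneg hp0,
    hasCompactSublevels_Ia hp, quasiconvexRate_Ia hp, symmetricRate_Ia hp0⟩
  · intro C hC c hc
    rcases lt_or_ge c 0 with hc0 | hc0
    · refine ⟨1, one_pos, Eventually.of_forall fun n => prob_le_one.trans ?_⟩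
      rw [one_mul, ← ENNReal.ofReal_one]
      refine ENNReal.ofReal_le_ofReal (Real.one_le_exp ?_)
      have := mul_nonneg n.cast_nonneg (neg_nonneg.2 hc0.le)
      linarith
    rcases C.eq_empty_or_nonempty with rfl | hne
    · exact ⟨1, one_pos, Eventually.of_forall fun n => by simp⟩
    obtain ⟨a, ha, hca, hsub⟩ := exists_subset_abs_ge hp hC hc0 hc hne
    have := isProbabilityMeasure_projLaw hp0
    obtain ⟨K, hK⟩ := pi_empMean_mem_closed_le (hasExpMoments_projLaw hp)
      (isClosed_quotTail hp0 a) (disjoint_quotTail hp ha.le hca)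
    refine ⟨K + 1, by positivity, ?_⟩
    filter_upwards [eventually_gt_atTop 0] with n hn
    have hA : MeasurableSet {t : ℝ | a ≤ |t|} :=
      measurableSet_le measurable_const measurable_id.abs
    have h1 := measure_scaled_dotp hn (hXmeas n) (hΘmeas n) (hX n hn) (hΘ n hn) (hIndep n)
      ((n : ℝ) ^ (1 / p - 1 / 2)) hA
    calc P {ω | (n : ℝ) ^ (1 / p - 1 / 2) * dotp (X n ω) (Θ n ω) ∈ C}
        ≤ P {ω | (n : ℝ) ^ (1 / p - 1 / 2) * dotp (X n ω) (Θ n ω) ∈ {t : ℝ | a ≤ |t|}} :=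
          measure_mono fun ω hω => hsub hω
      _ ≤ K * ENNReal.ofReal (Real.exp (-(n * c))) :=
          h1.trans_le ((prod_abs_ge_le hp0 hn ha.le).trans (hK n))
      _ ≤ ENNReal.ofReal ((K + 1) * Real.exp (-(n * c))) := by
          rw [← ENNReal.ofReal_natCast, ← ENNReal.ofReal_mul (by positivity)]
          gcongr
          linarith
  · intro G hG w hw c hc
    obtain ⟨r, ε, hr0, hr1, hε, hrG⟩ := exists_mul_mem_of_isOpen hG hw
    have hr : 0 < 1 - r := by linarith
    refine ⟨(1 - r) * (1 / 2), by positivity, ?_⟩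
    filter_upwards [eventually_le_pi_quotNear hp hε hc, eventually_gt_atTop 0] with n h hn
    rw [measure_scaled_dotp hn (hXmeas n) (hΘmeas n) (hX n hn) (hΘ n hn) (hIndep n) _
      hG.measurableSet, mul_assoc, ENNReal.ofReal_mul hr.le]
    refine le_trans ?_ (le_prod_near hp0 hn hr0 hr1 hG.measurableSet hrG)
    gcongr
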